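/- Let Φ be a local Zhou weight related to |f₀|²e^{-2φ₀} near o and let ψ₁, ψ₂ be psh functions near o. Then: (1) for any c₁ ≥ 0 and c₂ ≥ 0, σ(c₁ψ₁ + c₂ψ₂, Φ) = c₁σ(ψ₁, Φ) + c₂σ(ψ₂, Φ); (2) for holomorphic functions f₁, f₂ near o, σ(log|f₁+f₂|, Φ) ≥ min{ σ(log|f₁|, Φ), σ(log|f₂|, Φ) }; (3) σ(max{ψ₁, ψ₂}, Φ) = min{ σ(ψ₁, Φ), σ(ψ₂, Φ) }. -/

import Mathlib

open MeasureTheory Filter Topology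
open scoped ENNReal NNReal

noncomputable section

/-- `ℂⁿ`. -/
abbrev Cn (n : ℕ) : Type := Fin n → ℂ

variable {n : ℕ}

/-- The exponential function `EReal → ℝ≥0∞`, with `exp ⊥ = 0` and `exp ⊤ = ⊤`. -/
def expE (x : EReal) : ℝ≥0∞ :=
  if x = ⊥ then 0 else if x = ⊤ then ⊤ else ENNReal.ofReal (Real.exp x.toReal)

/-- The logarithm `ℝ → EReal`, with value `⊥` for `x ≤ 0`. -/
def elog (x : ℝ) : EReal := if x ≤ 0 then (⊥ : EReal) else ((Real.log x : ℝ) : EReal)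

/-- The density `e^{c·φ} : ℂⁿ → [0,∞]` associated to an extended-real-valued `φ`. -/
def wexp (c : ℝ) (φ : Cn n → EReal) (z : Cn n) : ℝ≥0∞ := expE ((c : EReal) * φ z)

/-- `|f₀|² = ∑ⱼ |f₀ⱼ|²` as a `[0,∞]`-valued density, for a tuple `f₀` of functions. -/
def normSq2 {m : ℕ} (f₀ : Fin m → Cn n → ℂ) (z : Cn n) : ℝ≥0∞ :=
  ∑ j, (‖f₀ j z‖₊ : ℝ≥0∞) ^ 2

/-- `log |f₀| = (1/2) log ∑ⱼ |f₀ⱼ|²` for a tuple `f₀`. -/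
def logAbsT {m : ℕ} (f₀ : Fin m → Cn n → ℂ) (z : Cn n) : EReal :=
  elog (Real.sqrt (∑ j, ‖f₀ j z‖ ^ 2))

/-- The weight `|f₀|² e^{-2φ₀}`. -/
def dens0 {m : ℕ} (f₀ : Fin m → Cn n → ℂ) (φ₀ : Cn n → EReal) (z : Cn n) : ℝ≥0∞ :=
  normSq2 f₀ z * wexp (-2) φ₀ z

/-- A nonnegative function is (Lebesgue-)integrable near the origin. -/
def IntNear (g : Cn n → ℝ≥0∞) : Prop := ∃ U ∈ 𝓝 (0 : Cn n), (∫⁻ z in U, g z) < ⊤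

/-- `ψ ≤ φ + O(1)` near the origin. -/
def leO (ψ φ : Cn n → EReal) : Prop := ∃ C : ℝ, ∀ᶠ z in 𝓝 (0 : Cn n), ψ z ≤ φ z + (C : EReal)

/-- `ψ = φ + O(1)` near the origin. -/
def eqO (ψ φ : Cn n → EReal) : Prop := leO ψ φ ∧ leO φ ψ

/-- The truncated average of `u` over the circle `θ ↦ z + r e^{iθ} w`, truncated below at `-m`. -/
def circleAvg (u : Cn n → EReal) (z w : Cn n) (r : ℝ) (m : ℕ) : ℝ :=
  (2 * Real.pi)⁻¹ * ∫ θ in (0:ℝ)..(2 * Real.pi),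
    (max (u (z + ((r : ℂ) * Complex.exp (Complex.I * (θ : ℂ))) • w)) ((-(m : ℝ) : ℝ) : EReal)).toReal

/-- `u` is plurisubharmonic on `Ω`: it is upper semicontinuous on `Ω`, takes values in
`[-∞, ∞)`, is not identically `-∞` on any connected component of `Ω`, and satisfies the
sub-mean value inequality on all small circles inside complex lines. -/
structure PSHOn (u : Cn n → EReal) (Ω : Set (Cn n)) : Prop where
  usc : UpperSemicontinuousOn u Ω
  lt_top : ∀ z ∈ Ω, u z < ⊤
  not_botOnComponents : ∀ z ∈ Ω, ∃ w ∈ connectedComponentIn Ω z, u w ≠ ⊥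
  submean : ∀ z ∈ Ω, ∀ w : Cn n, ∃ ε > 0, ∀ r : ℝ, 0 < r → r < ε →
    u z ≤ ⨅ m : ℕ, ((circleAvg u z w r m : ℝ) : EReal)

/-- `u` is plurisubharmonic near the origin. -/
def PSHNear (u : Cn n → EReal) : Prop := ∃ U ∈ 𝓝 (0 : Cn n), IsOpen U ∧ PSHOn u U

/-- `f` is holomorphic near the origin. -/
def HoloNear (f : Cn n → ℂ) : Prop := ∃ U ∈ 𝓝 (0 : Cn n), IsOpen U ∧ DifferentiableOn ℂ f U

/-- `Φ` is a (local) Zhou weight near the origin related to a general nonnegative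
weight `W`. -/
structure IsZhouWeightFor (W : Cn n → ℝ≥0∞) (Φ : Cn n → EReal) : Prop where
  psh : PSHNear Φ
  intN : ∃ N₁ : ℕ, ∀ N₀ : ℕ, N₁ ≤ N₀ →
    IntNear fun z => W z * ENNReal.ofReal (‖z‖ ^ (2 * N₀)) * wexp (-2) Φ z
  nonint : ¬ IntNear fun z => W z * wexp (-2) Φ z
  maximal : ∀ φ' : Cn n → EReal, PSHNear φ' → leO Φ φ' →
    (¬ IntNear fun z => W z * wexp (-2) φ' z) → eqO φ' Φ

/-- `Φ` is a local Zhou weight related to `|f₀|² e^{-2φ₀}` near the origin (including the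
standing assumptions that `f₀` is a tuple of holomorphic functions near `o`, `φ₀` is
plurisubharmonic near `o`, and `|f₀|² e^{-2φ₀}` is integrable near `o`). -/
structure IsLocalZhouWeight {m : ℕ} (f₀ : Fin m → Cn n → ℂ) (φ₀ : Cn n → EReal)
    (Φ : Cn n → EReal) : Prop where
  holo : ∀ j, HoloNear (f₀ j)
  psh₀ : PSHNear φ₀
  int₀ : IntNear (dens0 f₀ φ₀)
  zhou : IsZhouWeightFor (dens0 f₀ φ₀) Φ

/-- The Zhou number (relative type) `σ(ψ, Φ) = sup { b ≥ 0 : ψ ≤ bΦ + O(1) near o }`. -/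
def zhouNumber (ψ Φ : Cn n → EReal) : ℝ :=
  sSup {b : ℝ | 0 ≤ b ∧ leO ψ fun z => (b : EReal) * Φ z}

/-- `log ‖f‖ : ℂⁿ → EReal`. -/
def logAbs (f : Cn n → ℂ) (z : Cn n) : EReal := elog ‖f z‖

/-- `ν(f, Φ) = σ(log|f|, Φ)`. -/
def nuNumber (f : Cn n → ℂ) (Φ : Cn n → EReal) : ℝ := zhouNumber (logAbs f) Φ

/-- The jumping number `c_o^G(Φ) = sup { c ≥ 0 : |G|² e^{-2cΦ} integrable near o }`. -/
def jumping (G : Cn n → ℂ) (Φ : Cn n → EReal) : ℝ :=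
  sSup {c : ℝ | 0 ≤ c ∧ IntNear fun z => (‖G z‖₊ : ℝ≥0∞) ^ 2 * wexp (-2 * c) Φ z}

/-- The inclusion `ℐ(φ)ₒ ⊆ ℐ(ψ)ₒ` of multiplier ideals at the origin. -/
def mIdealLE (φ ψ : Cn n → EReal) : Prop :=
  ∀ f : Cn n → ℂ, HoloNear f →
    (IntNear fun z => (‖f z‖₊ : ℝ≥0∞) ^ 2 * wexp (-2) φ z) →
    IntNear fun z => (‖f z‖₊ : ℝ≥0∞) ^ 2 * wexp (-2) ψ z

/-- The Tian function `Tn(t; f, v, φ₀) = sup { c ≥ 0 : |f|^{2t} e^{-2cv - 2φ₀} integrable near o }`. -/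
def tian (t : ℝ) (f : Cn n → ℂ) (v φ₀ : Cn n → EReal) : ℝ :=
  sSup {c : ℝ | 0 ≤ c ∧
    IntNear fun z => ENNReal.ofReal (‖f z‖ ^ (2 * t)) * wexp (-2 * c) v z * wexp (-2) φ₀ z}

/-- The average over `[0, 2π]` of `F` truncated below at `-M`. -/
def truncAvg (F : ℝ → EReal) (M : ℝ) : ℝ :=
  (2 * Real.pi)⁻¹ * ∫ θ in (0:ℝ)..(2 * Real.pi), (max (F θ) ((-M : ℝ) : EReal)).toReal

theorem coe_toReal_max_of_lt_top {x : EReal} (hx : x < ⊤) (M : ℝ) :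
    ((max x ((-M : ℝ) : EReal)).toReal : EReal) = max x ((-M : ℝ) : EReal) := by
  apply EReal.coe_toReal
  · exact (max_lt hx (EReal.coe_lt_top _)).ne
  · exact ((EReal.bot_lt_coe _).trans_le (le_max_right _ _)).ne'

theorem exists_real_bound_of_isCompact {X : Type*} [TopologicalSpace X] {F : X → EReal} {K : Set X}
    (hK : IsCompact K) (hF : UpperSemicontinuousOn F K) (hlt : ∀ x ∈ K, F x < ⊤) :
    ∃ C : ℝ, ∀ x ∈ K, F x ≤ C := by
  rcases K.eq_empty_or_nonempty with rfl | hne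
  · exact ⟨0, by simp⟩
  obtain ⟨a, ha, hmax⟩ := hF.exists_isMaxOn hne hK
  refine ⟨(F a).toReal, fun x hx => (hmax hx).trans ?_⟩
  exact EReal.le_coe_toReal (hlt a ha).ne

theorem intervalIntegrable_trunc {F : ℝ → EReal} (hF : UpperSemicontinuous F)
    (hlt : ∀ θ, F θ < ⊤) (M : ℝ) :
    IntervalIntegrable (fun θ => (max (F θ) ((-M : ℝ) : EReal)).toReal) volume 0 (2 * Real.pi) := by
  obtain ⟨C, hC⟩ := exists_real_bound_of_isCompact (isCompact_Icc (a := (0:ℝ)) (b := 2 * Real.pi))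
    (hF.upperSemicontinuousOn _) (fun x _ => hlt x)
  have hm : Measurable fun θ => (max (F θ) ((-M : ℝ) : EReal)).toReal :=
    (hF.measurable.max measurable_const).ereal_toReal
  rw [intervalIntegrable_iff]
  refine Measure.integrableOn_of_bounded (M := max |C| |M|) (by simp [ENNReal.mul_eq_top]) hm.aestronglyMeasurable ?_
  refine (ae_restrict_iff' measurableSet_uIoc).2 (Eventually.of_forall fun θ hθ => ?_)
  rw [Set.uIoc_of_le (by positivity)] at hθ
  have h := hC θ ⟨hθ.1.le, hθ.2⟩
  have h1 := coe_toReal_max_of_lt_top (hlt θ) M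
  have h2 : (max (F θ) ((-M : ℝ) : EReal)).toReal ≤ max C (-M) := by
    rw [← EReal.coe_le_coe_iff, h1, EReal.coe_strictMono.monotone.map_max]
    exact max_le_max h le_rfl
  have h3 : -M ≤ (max (F θ) ((-M : ℝ) : EReal)).toReal := by
    rw [← EReal.coe_le_coe_iff, h1]
    exact le_max_right _ _
  rw [Real.norm_eq_abs, abs_le]
  constructor
  · have := le_max_right |C| |M|
    have := le_abs_self M
    linarith
  · exact h2.trans (max_le_max (le_abs_self _) (neg_le_abs _))

theorem truncAvg_mono {F G : ℝ → EReal} (hF : UpperSemicontinuous F) (hG : UpperSemicontinuous G)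
    (hFt : ∀ θ, F θ < ⊤) (hGt : ∀ θ, G θ < ⊤) {M M' : ℝ}
    (h : ∀ θ, max (F θ) ((-M : ℝ) : EReal) ≤ max (G θ) ((-M' : ℝ) : EReal)) :
    truncAvg F M ≤ truncAvg G M' := by
  unfold truncAvg
  refine mul_le_mul_of_nonneg_left ?_ (by positivity)
  refine intervalIntegral.integral_mono (by positivity) (intervalIntegrable_trunc hF hFt M)
    (intervalIntegrable_trunc hG hGt M') fun θ => ?_
  rw [← EReal.coe_le_coe_iff, coe_toReal_max_of_lt_top (hFt θ), coe_toReal_max_of_lt_top (hGt θ)]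
  exact h θ

theorem truncAvg_le_average {F : ℝ → EReal} (hF : UpperSemicontinuous F) {q : ℝ → ℝ}
    (hq : Continuous q) (h : ∀ θ, F θ ≤ q θ) {M : ℝ} (hM : ∀ θ, -M ≤ q θ) :
    truncAvg F M ≤ (2 * Real.pi)⁻¹ * ∫ θ in (0:ℝ)..(2 * Real.pi), q θ := by
  have h1 : (2 * Real.pi)⁻¹ * ∫ θ in (0:ℝ)..(2 * Real.pi), q θ
      = truncAvg (fun θ => (q θ : EReal)) M := by
    unfold truncAvg
    congr 2
    ext θ
    rw [← EReal.coe_strictMono.monotone.map_max, EReal.toReal_coe, max_eq_left (hM θ)]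
  rw [h1]
  refine truncAvg_mono hF ?_ (fun θ => (h θ).trans_lt (EReal.coe_lt_top _))
    (fun θ => EReal.coe_lt_top _) (fun θ => max_le_max (h θ) le_rfl)
  exact (continuous_coe_real_ereal.comp hq).upperSemicontinuous

theorem average_le_truncAvg {F : ℝ → EReal} (hF : UpperSemicontinuous F) (hFt : ∀ θ, F θ < ⊤)
    {q : ℝ → ℝ} (hq : Continuous q) (h : ∀ θ, (q θ : EReal) ≤ F θ) (M : ℝ) :
    (2 * Real.pi)⁻¹ * ∫ θ in (0:ℝ)..(2 * Real.pi), q θ ≤ truncAvg F M := by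
  unfold truncAvg
  refine mul_le_mul_of_nonneg_left ?_ (by positivity)
  refine intervalIntegral.integral_mono (by positivity) (hq.intervalIntegrable _ _)
    (intervalIntegrable_trunc hF hFt M) fun θ => ?_
  rw [← EReal.coe_le_coe_iff, coe_toReal_max_of_lt_top (hFt θ)]
  exact (h θ).trans (le_max_left _ _)

/-- The point `z + r e^{iθ} w` of the circle with centre `z`, radius `r` and direction `w`. -/
def circlePt (z w : Cn n) (r θ : ℝ) : Cn n :=
  z + ((r : ℂ) * Complex.exp (Complex.I * (θ : ℂ))) • w

theorem continuous_circlePt (z w : Cn n) (r : ℝ) : Continuous (circlePt z w r) := by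
  unfold circlePt
  fun_prop

theorem dist_circlePt_le (z w : Cn n) {r : ℝ} (hr : 0 ≤ r) (θ : ℝ) :
    dist (circlePt z w r θ) z ≤ r * ‖w‖ := by
  have : ‖Complex.exp (Complex.I * (θ : ℂ))‖ = 1 := by
    rw [mul_comm, Complex.norm_exp_ofReal_mul_I]
  simp [circlePt, norm_smul, this, abs_of_nonneg hr]

/-- The sub-mean value inequality of `u` on the circle `circlePt z w r`, for all truncations. -/
def SubMean (u : Cn n → EReal) (z w : Cn n) (r : ℝ) : Prop :=
  ∀ M : ℝ, u z ≤ (truncAvg (fun θ => u (circlePt z w r θ)) M : ℝ)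

theorem exists_circlePt_mem {U : Set (Cn n)} (hU : IsOpen U) {z : Cn n} (hz : z ∈ U) (w : Cn n) :
    ∃ ε > 0, ∀ r : ℝ, 0 < r → r < ε → ∀ θ, circlePt z w r θ ∈ U := by
  obtain ⟨δ, hδ, hb⟩ := Metric.isOpen_iff.1 hU z hz
  refine ⟨δ / (‖w‖ + 1), by positivity, fun r hr hrε θ => hb ?_⟩
  rw [lt_div_iff₀ (by positivity)] at hrε
  have := dist_circlePt_le z w hr.le θ
  rw [Metric.mem_ball]
  nlinarith

theorem upperSemicontinuous_comp_of_mem {X Y : Type*} [TopologicalSpace X] [TopologicalSpace Y]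
    {u : Y → EReal} {U : Set Y} (hu : UpperSemicontinuousOn u U) {γ : X → Y} (hγ : Continuous γ)
    (h : ∀ x, γ x ∈ U) : UpperSemicontinuous fun x => u (γ x) := by
  intro x a ha
  have := hu (γ x) (h x) a ha
  have ht : Tendsto γ (𝓝 x) (𝓝[U] (γ x)) :=
    tendsto_nhdsWithin_iff.2 ⟨hγ.continuousAt, Eventually.of_forall h⟩
  exact ht.eventually this

theorem subMean_iff_circleAvg {u : Cn n → EReal} {U : Set (Cn n)} (hu : UpperSemicontinuousOn u U)
    (ht : ∀ z ∈ U, u z < ⊤) {z w : Cn n} {r : ℝ} (hc : ∀ θ, circlePt z w r θ ∈ U) :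
    SubMean u z w r ↔ u z ≤ ⨅ m : ℕ, ((circleAvg u z w r m : ℝ) : EReal) := by
  have hF := upperSemicontinuous_comp_of_mem hu (continuous_circlePt z w r) hc
  constructor
  · intro h
    exact le_iInf fun m => h m
  · intro h M
    obtain ⟨m, hm⟩ := exists_nat_ge M
    refine (h.trans (iInf_le _ m)).trans (EReal.coe_le_coe_iff.2 ?_)
    refine truncAvg_mono (M := (m : ℝ)) hF hF (fun θ => ht _ (hc θ)) (fun θ => ht _ (hc θ)) fun θ => ?_
    exact max_le_max le_rfl (EReal.coe_le_coe_iff.2 (by linarith))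

theorem PSHOn.exists_subMean {u : Cn n → EReal} {U : Set (Cn n)} (hU : IsOpen U) (hu : PSHOn u U)
    {z : Cn n} (hz : z ∈ U) (w : Cn n) :
    ∃ ε > 0, ∀ r : ℝ, 0 < r → r < ε → SubMean u z w r := by
  obtain ⟨ε, hε, h⟩ := hu.submean z hz w
  obtain ⟨δ, hδ, h'⟩ := exists_circlePt_mem hU hz w
  refine ⟨min ε δ, lt_min hε hδ, fun r hr hrm => ?_⟩
  exact (subMean_iff_circleAvg hu.usc hu.lt_top (h' r hr (hrm.trans_le (min_le_right _ _)))).2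
    (h r hr (hrm.trans_le (min_le_left _ _)))

theorem SubMean.mono {u v : Cn n → EReal} {U : Set (Cn n)} (hu : UpperSemicontinuousOn u U)
    (hv : UpperSemicontinuousOn v U) (hvt : ∀ z ∈ U, v z < ⊤) (huv : ∀ z ∈ U, u z ≤ v z)
    {z w : Cn n} {r : ℝ} (hc : ∀ θ, circlePt z w r θ ∈ U) (h : SubMean u z w r) (M : ℝ) :
    u z ≤ (truncAvg (fun θ => v (circlePt z w r θ)) M : ℝ) := by
  refine (h M).trans (EReal.coe_le_coe_iff.2 ?_)
  exact truncAvg_mono (upperSemicontinuous_comp_of_mem hu (continuous_circlePt z w r) hc)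
    (upperSemicontinuous_comp_of_mem hv (continuous_circlePt z w r) hc)
    (fun θ => (huv _ (hc θ)).trans_lt (hvt _ (hc θ))) (fun θ => hvt _ (hc θ))
    (fun θ => max_le_max (huv _ (hc θ)) le_rfl)

theorem SubMean.max {u v : Cn n → EReal} {U : Set (Cn n)} (hu : UpperSemicontinuousOn u U)
    (hv : UpperSemicontinuousOn v U) (hut : ∀ z ∈ U, u z < ⊤) (hvt : ∀ z ∈ U, v z < ⊤)
    {z w : Cn n} {r : ℝ} (hc : ∀ θ, circlePt z w r θ ∈ U)
    (h : SubMean u z w r) (h' : SubMean v z w r) : SubMean (fun z => max (u z) (v z)) z w r := by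
  have hm : UpperSemicontinuousOn (fun z => Max.max (u z) (v z)) U := hu.sup hv
  intro M
  exact max_le
    (h.mono hu hm (fun z hz => max_lt (hut z hz) (hvt z hz)) (fun z _ => le_max_left _ _) hc M)
    (h'.mono hv hm (fun z hz => max_lt (hut z hz) (hvt z hz)) (fun z _ => le_max_right _ _) hc M)

/-- `x ↦ a x + b` on extended reals, for `a > 0`. -/
theorem affine_lt_top {a : ℝ} (ha : 0 < a) (b : ℝ) {x : EReal} (hx : x < ⊤) :
    (a : EReal) * x + b < ⊤ := by
  induction x with
  | bot => simp [EReal.coe_mul_bot_of_pos ha]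
  | coe x => exact_mod_cast EReal.coe_lt_top (a * x + b)
  | top => simp at hx

theorem affine_mono {a : ℝ} (ha : 0 < a) (b : ℝ) : Monotone fun x : EReal => (a : EReal) * x + b := by
  intro x y hxy
  exact add_le_add_left (mul_le_mul_of_nonneg_left hxy (by exact_mod_cast ha.le)) _

theorem continuous_affine {a : ℝ} (ha : 0 < a) (b : ℝ) :
    Continuous fun x : EReal => (a : EReal) * x + b := by
  have h1 : Continuous fun x : EReal => (a : EReal) * x := by
    have ha' : (a : EReal) ≠ 0 := by exact_mod_cast ha.ne'
    refine continuous_iff_continuousAt.2 fun x => ?_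
    exact (EReal.continuousAt_mul (p := ((a : EReal), x)) (Or.inl ha') (Or.inl ha')
      (Or.inl (EReal.coe_ne_bot a)) (Or.inl (EReal.coe_ne_top a))).comp
      (continuousAt_const.prodMk continuousAt_id)
  refine continuous_iff_continuousAt.2 fun x => ?_
  refine (EReal.continuousAt_add (Or.inr (EReal.coe_ne_bot b)) (Or.inr (EReal.coe_ne_top b))).comp
    (h1.continuousAt.prodMk continuousAt_const)

theorem SubMean.affine {u : Cn n → EReal} {U : Set (Cn n)} (hu : UpperSemicontinuousOn u U)
    (hut : ∀ z ∈ U, u z < ⊤) {z w : Cn n} {r : ℝ} (hc : ∀ θ, circlePt z w r θ ∈ U)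
    (h : SubMean u z w r) {a : ℝ} (ha : 0 < a) (b : ℝ) :
    SubMean (fun z => (a : EReal) * u z + b) z w r := by
  intro M
  have hF := upperSemicontinuous_comp_of_mem hu (continuous_circlePt z w r) hc
  have key : truncAvg (fun θ => (a : EReal) * u (circlePt z w r θ) + b) M
      = a * truncAvg (fun θ => u (circlePt z w r θ)) ((M + b) / a) + b := by
    have hInt := intervalIntegrable_trunc hF (fun θ => hut _ (hc θ)) ((M + b) / a)
    unfold truncAvg
    have : ∀ θ, (Max.max ((a : EReal) * u (circlePt z w r θ) + b) ((-M : ℝ) : EReal)).toReal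
        = a * (Max.max (u (circlePt z w r θ)) ((-((M + b) / a) : ℝ) : EReal)).toReal + b := by
      intro θ
      have hlt := hut _ (hc θ)
      have e : ((-M : ℝ) : EReal) = (a : EReal) * ((-((M + b) / a) : ℝ) : EReal) + b := by
        norm_cast
        field_simp
        ring
      rw [e, ← (affine_mono ha b).map_max]
      have hc := coe_toReal_max_of_lt_top hlt ((M + b) / a)
      set y := (Max.max (u (circlePt z w r θ)) ((-((M + b) / a) : ℝ) : EReal)).toReal
      rw [← hc]
      norm_cast
    simp_rw [this]
    rw [intervalIntegral.integral_add (hInt.const_mul a) intervalIntegrable_const,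
      intervalIntegral.integral_const_mul]
    simp
    field_simp
  rw [key]
  have := affine_mono ha b (h ((M + b) / a))
  simpa using this

/-- `g` is upper semicontinuous on the closed unit disc, takes no value `⊤` there, and satisfies the
sub-mean value inequality on small circles around each point of the open unit disc. -/
structure SubharmonicDisc (g : ℂ → EReal) : Prop where
  usc : UpperSemicontinuousOn g (Metric.closedBall 0 1)
  lt_top : ∀ ζ ∈ Metric.closedBall (0 : ℂ) 1, g ζ < ⊤
  submean : ∀ a ∈ Metric.ball (0 : ℂ) 1, ∃ ε > 0, ∀ r : ℝ, 0 < r → r < ε →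
    ∀ M : ℝ, g a ≤ (truncAvg (fun θ => g (circleMap a r θ)) M : ℝ)

theorem average_re_circleMap {H : ℂ → ℂ} (hH : Differentiable ℂ H) (a : ℂ) (r : ℝ) :
    (2 * Real.pi)⁻¹ * ∫ θ in (0:ℝ)..(2 * Real.pi), (H (circleMap a r θ)).re = (H a).re := by
  have h1 : Real.circleAverage H a r = H a :=
    (hH.diffContOnCl (s := Metric.ball a |r|)).circleAverage
  have h2 := congrArg Complex.re h1
  rw [Real.circleAverage_def, Complex.smul_re] at h2
  rw [← h2, smul_eq_mul]
  congr 1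
  have hi : IntervalIntegrable (fun θ => H (circleMap a r θ)) volume 0 (2 * Real.pi) :=
    (hH.continuous.comp (continuous_circleMap a r)).intervalIntegrable _ _
  simpa using Complex.reCLM.intervalIntegral_comp_comm hi

theorem normSq_circleMap (a : ℂ) (r θ : ℝ) :
    ‖circleMap a r θ‖ ^ 2
      = ((‖a‖ ^ 2 + r ^ 2 : ℝ) + 2 * (starRingEnd ℂ a) * (circleMap a r θ - a) : ℂ).re := by
  rw [← Complex.normSq_eq_norm_sq, ← Complex.normSq_eq_norm_sq]
  have hn : Complex.normSq (circleMap a r θ - a) = r ^ 2 := by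
    rw [Complex.normSq_eq_norm_sq, circleMap_sub_center, norm_circleMap_zero, sq_abs]
  simp only [Complex.normSq_apply, Complex.sub_re, Complex.sub_im, Complex.add_re, Complex.mul_re,
    Complex.mul_im, Complex.ofReal_re, Complex.conj_re, Complex.conj_im, Complex.re_ofNat,
    Complex.im_ofNat] at hn ⊢
  linarith

theorem SubharmonicDisc.le_re_center {g : ℂ → EReal} (hg : SubharmonicDisc g) {p : ℂ → ℂ}
    (hp : Differentiable ℂ p) (h : ∀ ζ ∈ Metric.sphere (0 : ℂ) 1, g ζ ≤ ((p ζ).re : ℝ)) :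
    g 0 ≤ ((p 0).re : ℝ) := by
  by_contra! hlt
  obtain ⟨y, hy1, hy2⟩ := EReal.lt_iff_exists_real_btwn.1 hlt
  have hy1 : (p 0).re < y := by exact_mod_cast hy1
  set η := y - (p 0).re with hη
  have hηpos : 0 < η := by linarith
  set d : ℂ → ℝ := fun ζ => -(p ζ).re + η * ‖ζ‖ ^ 2 with hd
  have hdc : Continuous d := by
    have := hp.continuous
    fun_prop
  set v : ℂ → EReal := fun ζ => g ζ + (d ζ : EReal) with hv
  have hvusc : UpperSemicontinuousOn v (Metric.closedBall 0 1) := by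
    refine hg.usc.add' (continuous_coe_real_ereal.comp hdc).continuousOn.upperSemicontinuousOn ?_
    intro x _
    exact EReal.continuousAt_add (Or.inr (EReal.coe_ne_bot _)) (Or.inr (EReal.coe_ne_top _))
  obtain ⟨a, ha, hmax⟩ := hvusc.exists_isMaxOn ⟨0, by simp⟩ (isCompact_closedBall _ _)
  have hv0 : (η : EReal) < v 0 := by
    have : v 0 = g 0 + ((-(p 0).re : ℝ) : EReal) := by simp [hv, hd]
    rw [this]
    have h2 : (η : EReal) = (y : EReal) + ((-(p 0).re : ℝ) : EReal) := by
      rw [hη]; norm_cast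
    rw [h2]
    exact EReal.add_lt_add_right_coe hy2 _
  have hva : (η : EReal) < v a := hv0.trans_le (hmax (by simp))
  have hab : a ∈ Metric.ball (0 : ℂ) 1 := by
    rw [mem_ball_zero_iff]
    have hle : ‖a‖ ≤ 1 := by simpa using ha
    refine lt_of_le_of_ne hle fun heq => ?_
    have h1 := h a (by simpa using heq)
    have h2 : v a ≤ η := by
      calc v a ≤ ((p a).re : EReal) + (d a : EReal) := add_le_add_left h1 _
        _ = η := by rw [← EReal.coe_add]; simp [hd, heq]
    exact absurd hva h2.not_gt
  have hgat := hg.lt_top a ha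
  have hgab : g a ≠ ⊥ := by
    intro hb
    simp [hv, hb] at hva
  lift g a to ℝ using ⟨hgat.ne, hgab⟩ with ga hga
  have hva' : v a = ((ga + d a : ℝ) : EReal) := by simp [hv, ← hga]
  obtain ⟨ε, hε, hs⟩ := hg.submean a hab
  have hab' : 0 < 1 - ‖a‖ := by
    have := mem_ball_zero_iff.1 hab
    linarith
  set r := min (ε / 2) (1 - ‖a‖) with hr
  have hr0 : 0 < r := lt_min (by linarith) hab'
  have hrε : r < ε := (min_le_left _ _).trans_lt (by linarith)
  have hcm : ∀ θ, circleMap a r θ ∈ Metric.closedBall (0 : ℂ) 1 := by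
    intro θ
    rw [mem_closedBall_zero_iff]
    have h1 : ‖circleMap a r θ - a‖ = r := by
      rw [circleMap_sub_center, norm_circleMap_zero, abs_of_pos hr0]
    have h2 : ‖circleMap a r θ‖ ≤ ‖circleMap a r θ - a‖ + ‖a‖ := by
      have := norm_add_le (circleMap a r θ - a) a
      rwa [sub_add_cancel] at this
    have h3 : r ≤ 1 - ‖a‖ := min_le_right _ _
    linarith
  set H : ℂ → ℂ := fun ζ => ((ga + d a : ℝ) : ℂ) + p ζ
    - (η : ℂ) * ((‖a‖ ^ 2 + r ^ 2 : ℝ) + 2 * (starRingEnd ℂ a) * (ζ - a)) with hH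
  have hHd : Differentiable ℂ H := by
    rw [hH]
    fun_prop
  have hle : ∀ θ, g (circleMap a r θ) ≤ ((H (circleMap a r θ)).re : ℝ) := by
    intro θ
    have h1 : v (circleMap a r θ) ≤ ((ga + d a : ℝ) : EReal) := hva' ▸ hmax (hcm θ)
    have h2 : (H (circleMap a r θ)).re = ga + d a - d (circleMap a r θ) := by
      rw [hH]
      simp only [Complex.sub_re, Complex.add_re, Complex.ofReal_re, Complex.re_ofReal_mul]
      have := normSq_circleMap a r θ
      simp only [Complex.add_re, Complex.ofReal_re] at this
      rw [← this, hd]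
      ring
    rw [h2, EReal.coe_sub]
    exact (EReal.le_sub_iff_add_le (Or.inl (EReal.coe_ne_bot _)) (Or.inl (EReal.coe_ne_top _))).2 h1
  have hqc : Continuous fun θ => (H (circleMap a r θ)).re :=
    Complex.continuous_re.comp (hHd.continuous.comp (continuous_circleMap a r))
  obtain ⟨m, hm⟩ := ((isCompact_closedBall (0 : ℂ) 1).image
    (Complex.continuous_re.comp hHd.continuous)).bddBelow
  have hm' : ∀ θ, -(-m) ≤ (H (circleMap a r θ)).re := fun θ => by
    rw [neg_neg]
    exact hm ⟨_, hcm θ, rfl⟩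
  have hfin := (hs r hr0 hrε (-m)).trans (EReal.coe_le_coe_iff.2 (truncAvg_le_average
    (upperSemicontinuous_comp_of_mem hg.usc (continuous_circleMap a r) hcm) hqc hle hm'))
  rw [average_re_circleMap hHd, ← hga, EReal.coe_le_coe_iff] at hfin
  have hHa : (H a).re = ga - η * r ^ 2 := by
    rw [hH]
    simp only [Complex.sub_re, Complex.add_re, Complex.ofReal_re, Complex.re_ofReal_mul, sub_self,
      mul_zero, Complex.zero_re, hd]
    ring
  rw [hHa] at hfin
  have : 0 < η * r ^ 2 := by positivity
  linarith

instance : Fact (0 < 2 * Real.pi) := ⟨Real.two_pi_pos⟩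

theorem exists_polynomial_of_mem_span_fourier {f : C(AddCircle (2 * Real.pi), ℂ)}
    (hf : f ∈ Submodule.span ℂ (Set.range (@fourier (2 * Real.pi)))) :
    ∃ p q : Polynomial ℂ, (∀ x, f x = p.eval (AddCircle.toCircle x : ℂ)
        + starRingEnd ℂ (q.eval (AddCircle.toCircle x : ℂ))) ∧
      ∫ x, f x ∂AddCircle.haarAddCircle = p.eval 0 + starRingEnd ℂ (q.eval 0) := by
  induction hf using Submodule.span_induction with
  | mem f hf =>
    obtain ⟨k, rfl⟩ := hf
    have hInt : ∫ x, fourier k x ∂(AddCircle.haarAddCircle (T := 2 * Real.pi))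
        = if k = 0 then 1 else 0 := by
      have h := congrFun (fourierCoeff_fourier (T := 2 * Real.pi) k) 0
      rw [fourierCoeff] at h
      simpa [Pi.single_apply, eq_comm] using h
    rcases le_total 0 k with hk | hk
    · lift k to ℕ using hk
      refine ⟨Polynomial.X ^ k, 0, fun x => ?_, ?_⟩
      · simp [fourier_apply, AddCircle.toCircle_nsmul]
      · rw [hInt]; simp [zero_pow_eq]
    · obtain ⟨j, rfl⟩ : ∃ j : ℕ, k = -(j : ℤ) := ⟨k.natAbs, by omega⟩
      refine ⟨0, Polynomial.X ^ j, fun x => ?_, ?_⟩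
      · rw [fourier_neg]; simp [fourier_apply, AddCircle.toCircle_nsmul]
      · rw [hInt]; simp [zero_pow_eq, apply_ite]
  | zero => exact ⟨0, 0, by simp, by simp⟩
  | add f g _ _ hf hg =>
    obtain ⟨p, q, h, h'⟩ := hf
    obtain ⟨p₁, q₁, h₁, h₁'⟩ := hg
    refine ⟨p + p₁, q + q₁, fun x => ?_, ?_⟩
    · simp [h, h₁]; ring
    · have : ∀ f : C(AddCircle (2 * Real.pi), ℂ), Integrable f AddCircle.haarAddCircle :=
        fun f => f.continuous.integrable_of_hasCompactSupport (HasCompactSupport.of_compactSpace _)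
      simp only [ContinuousMap.add_apply]
      rw [integral_add (this f) (this g), h', h₁']; simp; ring
  | smul c f _ hf =>
    obtain ⟨p, q, h, h'⟩ := hf
    refine ⟨Polynomial.C c * p, Polynomial.C (starRingEnd ℂ c) * q, fun x => ?_, ?_⟩
    · simp [h]; ring
    · simp only [ContinuousMap.smul_apply, smul_eq_mul]
      rw [integral_const_mul, h']; simp; ring

theorem exists_polynomial_re_near (h : C(AddCircle (2 * Real.pi), ℝ)) {δ : ℝ} (hδ : 0 < δ) :
    ∃ p : Polynomial ℂ, (∀ x, |h x - (p.eval (AddCircle.toCircle x : ℂ)).re| ≤ δ) ∧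
      |∫ x, h x ∂AddCircle.haarAddCircle - (p.eval 0).re| ≤ δ := by
  let hc : C(AddCircle (2 * Real.pi), ℂ) := ⟨fun x => (h x : ℂ), by fun_prop⟩
  have hmem : hc ∈ closure
      (Submodule.span ℂ (Set.range (@fourier (2 * Real.pi))) : Set C(AddCircle (2 * Real.pi), ℂ)) := by
    have := span_fourier_closure_eq_top (T := 2 * Real.pi)
    rw [← Submodule.topologicalClosure_coe, this]
    trivial
  obtain ⟨f, hf, hd⟩ := Metric.mem_closure_iff.1 hmem δ hδ
  obtain ⟨p, q, h1, h2⟩ := exists_polynomial_of_mem_span_fourier hf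
  have hnorm : ∀ x, ‖hc x - f x‖ ≤ δ := fun x => by
    rw [← dist_eq_norm]
    exact (ContinuousMap.dist_apply_le_dist x).trans hd.le
  have hi : ∀ f : C(AddCircle (2 * Real.pi), ℂ), Integrable f AddCircle.haarAddCircle :=
    fun f => f.continuous.integrable_of_hasCompactSupport (HasCompactSupport.of_compactSpace _)
  refine ⟨p + q, fun x => ?_, ?_⟩
  · refine le_trans ?_ (hnorm x)
    refine le_trans (le_of_eq ?_) (Complex.abs_re_le_norm _)
    rw [h1]
    simp [hc]
  · have h3 : ‖∫ x, (hc x - f x) ∂AddCircle.haarAddCircle‖ ≤ δ := by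
      simpa using norm_integral_le_of_norm_le_const (μ := AddCircle.haarAddCircle)
        (Eventually.of_forall hnorm)
    rw [integral_sub (hi _) (hi _), h2] at h3
    refine le_trans (le_of_eq ?_) ((Complex.abs_re_le_norm _).trans h3)
    have : ∫ x, hc x ∂AddCircle.haarAddCircle
        = ((∫ x, h x ∂AddCircle.haarAddCircle : ℝ) : ℂ) := integral_ofReal
    rw [this]
    simp

theorem SubharmonicDisc.haar_bot_eq_zero {g : ℂ → EReal} (hg : SubharmonicDisc g) (h0 : g 0 ≠ ⊥) :
    AddCircle.haarAddCircle {x : AddCircle (2 * Real.pi) | g (AddCircle.toCircle x : ℂ) = ⊥} = 0 := by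
  by_contra hpos
  have hcl : ∀ x : AddCircle (2 * Real.pi),
      (AddCircle.toCircle x : ℂ) ∈ Metric.closedBall (0 : ℂ) 1 := fun x =>
    mem_closedBall_zero_iff.2 (Circle.norm_coe _).le
  have hcont : Continuous fun x : AddCircle (2 * Real.pi) => (AddCircle.toCircle x : ℂ) :=
    continuous_subtype_val.comp AddCircle.continuous_toCircle
  have husc := upperSemicontinuous_comp_of_mem hg.usc hcont hcl
  have hmeas : MeasurableSet {x : AddCircle (2 * Real.pi) | g (AddCircle.toCircle x : ℂ) = ⊥} :=
    husc.measurable (measurableSet_singleton ⊥)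
  obtain ⟨K, hKsub, hK, hKpos⟩ := hmeas.exists_lt_isCompact (pos_iff_ne_zero.2 hpos)
  set κ := (AddCircle.haarAddCircle K).toReal with hκ
  have hκpos : 0 < κ := ENNReal.toReal_pos hKpos.ne' (measure_ne_top _ _)
  obtain ⟨C, hC⟩ := exists_real_bound_of_isCompact (isCompact_closedBall (0 : ℂ) 1) hg.usc hg.lt_top
  set C' := max C 0 with hC'
  refine h0 (EReal.eq_bot_iff_forall_lt _ |>.2 fun y => ?_)
  obtain ⟨m, hm⟩ := exists_nat_gt ((C' + 3 - y) / κ)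
  rw [div_lt_iff₀ hκpos] at hm
  set O := {x : AddCircle (2 * Real.pi) | g (AddCircle.toCircle x : ℂ) < ((-(m : ℝ) : ℝ) : EReal)}
    with hO
  have hOo : IsOpen O := husc.isOpen_preimage _
  have hKO : Disjoint Oᶜ K := by
    rw [Set.disjoint_compl_left_iff_subset]
    intro x hx
    have : g (AddCircle.toCircle x : ℂ) = ⊥ := hKsub hx
    simp only [hO, Set.mem_ofPred_eq, this]
    exact EReal.bot_lt_coe _
  obtain ⟨χ, hχ0, hχ1, hχ⟩ := exists_continuous_zero_one_of_isClosed hOo.isClosed_compl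
    hK.isClosed hKO
  let h : C(AddCircle (2 * Real.pi), ℝ) := ⟨fun x => C' - (C' + m) * χ x, by fun_prop⟩
  have hgh : ∀ x, g (AddCircle.toCircle x : ℂ) ≤ (h x : ℝ) := by
    intro x
    have hC0 : 0 ≤ C' := le_max_right _ _
    by_cases hx : x ∈ O
    · refine (le_of_lt hx).trans (EReal.coe_le_coe_iff.2 ?_)
      have := (hχ x).2
      change -(m : ℝ) ≤ C' - (C' + m) * χ x
      have hm0 : (0:ℝ) ≤ m := by positivity
      nlinarith
    · have : χ x = 0 := hχ0 hx
      refine (hC _ (hcl x)).trans (EReal.coe_le_coe_iff.2 ?_)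
      change C ≤ C' - (C' + m) * χ x
      rw [this]
      simp [hC']
  obtain ⟨p, hp1, hp2⟩ := exists_polynomial_re_near h one_pos
  have hle := hg.le_re_center (p := fun ζ => p.eval ζ + 1) (by fun_prop) (fun ζ hζ => ?_)
  · refine hle.trans_lt (EReal.coe_lt_coe_iff.2 ?_)
    have hi : ∀ f : C(AddCircle (2 * Real.pi), ℝ), Integrable f AddCircle.haarAddCircle :=
      fun f => f.continuous.integrable_of_hasCompactSupport (HasCompactSupport.of_compactSpace _)
    have hInt : ∫ x, h x ∂AddCircle.haarAddCircle
        = C' - (C' + m) * ∫ x, χ x ∂AddCircle.haarAddCircle := by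
      change ∫ x, (C' - (C' + m) * χ x) ∂AddCircle.haarAddCircle = _
      rw [integral_sub (integrable_const _) ((hi χ).const_mul _), integral_const_mul]
      simp
    have hχint : κ ≤ ∫ x, χ x ∂AddCircle.haarAddCircle := by
      have h1 : ∫ x, K.indicator (fun _ => (1 : ℝ)) x ∂AddCircle.haarAddCircle = κ := by
        rw [integral_indicator hK.measurableSet]
        simp [hκ, Measure.real]
      rw [← h1]
      refine integral_mono ((integrable_const _).indicator hK.measurableSet) (hi χ) fun x => ?_
      by_cases hx : x ∈ K
      · simp [hx, hχ1 hx]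
      · simp [hx, (hχ x).1]
    have h2 := (abs_le.1 hp2).1
    rw [hInt] at h2
    have hC0 : 0 ≤ C' := le_max_right _ _
    have hm0 : (0:ℝ) ≤ m := by positivity
    simp only [Complex.add_re, Complex.one_re]
    have h3 := mul_le_mul_of_nonneg_left hχint (add_nonneg hC0 hm0)
    have h4 := mul_nonneg hC0 hκpos.le
    nlinarith
  · have hx' : (AddCircle.toCircle (Complex.arg ζ : AddCircle (2 * Real.pi)) : ℂ) = ζ := by
      rw [AddCircle.toCircle_apply_mk, div_self Real.two_pi_pos.ne', one_mul, Circle.coe_exp]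
      have := Complex.norm_mul_exp_arg_mul_I ζ
      rwa [mem_sphere_zero_iff_norm.1 hζ, Complex.ofReal_one, one_mul] at this
    set x : AddCircle (2 * Real.pi) := (Complex.arg ζ : AddCircle (2 * Real.pi))
    rw [← hx']
    refine (hgh x).trans (EReal.coe_le_coe_iff.2 ?_)
    have := (abs_le.1 (hp1 x)).2
    simp only [Complex.add_re, Complex.one_re]
    linarith

theorem measurable_restrict_of_upperSemicontinuousOn {X : Type*} [TopologicalSpace X]
    [MeasurableSpace X] [BorelSpace X] {u : X → EReal} {U : Set X}
    (hu : UpperSemicontinuousOn u U) : Measurable fun x : U => u x :=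
  (upperSemicontinuous_comp_of_mem hu continuous_subtype_val fun x => x.2).measurable

theorem measurableSet_inter_bot {X : Type*} [TopologicalSpace X]
    [MeasurableSpace X] [BorelSpace X] {u : X → EReal} {U : Set X} (hU : MeasurableSet U)
    (hu : UpperSemicontinuousOn u U) : MeasurableSet (U ∩ {y | u y = ⊥}) := by
  have h := hU.subtype_image
    (measurable_restrict_of_upperSemicontinuousOn hu (measurableSet_singleton ⊥))
  convert h using 1
  ext y
  simp [and_comm]

theorem PSHOn.subharmonicDisc {u : Cn n → EReal} {U : Set (Cn n)} (hU : IsOpen U) (hu : PSHOn u U)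
    {z w : Cn n} {r : ℝ} (hr : Metric.ball z r ⊆ U) (hw : ‖w‖ < r) :
    SubharmonicDisc fun ζ : ℂ => u (z + ζ • w) := by
  have hmem : ∀ ζ ∈ Metric.closedBall (0 : ℂ) 1, z + ζ • w ∈ U := by
    intro ζ hζ
    apply hr
    rw [mem_closedBall_zero_iff] at hζ
    rw [mem_ball_iff_norm, add_sub_cancel_left, norm_smul]
    nlinarith [norm_nonneg w]
  refine ⟨?_, fun ζ hζ => hu.lt_top _ (hmem ζ hζ), fun a ha => ?_⟩
  · exact hu.usc.comp (by fun_prop) hmem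
  · obtain ⟨ε, hε, h⟩ := hu.exists_subMean hU (hmem a (Metric.ball_subset_closedBall ha)) w
    refine ⟨ε, hε, fun r hr hrε M => ?_⟩
    have := h r hr hrε M
    convert this using 4 with θ
    simp only [circlePt, circleMap]
    rw [add_smul, add_assoc, mul_comm Complex.I]

theorem PSHOn.volume_ball_bot {u : Cn n → EReal} {U : Set (Cn n)} (hU : IsOpen U) (hu : PSHOn u U)
    {z : Cn n} {r : ℝ} (hr : Metric.ball z r ⊆ U) (h0 : u z ≠ ⊥) :
    volume (Metric.ball z r ∩ {y | u y = ⊥}) = 0 := by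
  set N := Metric.ball z r ∩ {y | u y = ⊥} with hN
  have hNm : MeasurableSet N :=
    measurableSet_inter_bot measurableSet_ball (hu.usc.mono hr)
  let f : Cn n × AddCircle (2 * Real.pi) → Cn n := fun p => z + (AddCircle.toCircle p.2 : ℂ) • p.1
  have hf : Continuous f := by
    have : Continuous fun x : AddCircle (2 * Real.pi) => (AddCircle.toCircle x : ℂ) :=
      continuous_subtype_val.comp AddCircle.continuous_toCircle
    fun_prop
  have hS : MeasurableSet (f ⁻¹' N) := hf.measurable hNm
  have hprod : (volume.prod AddCircle.haarAddCircle) (f ⁻¹' N) = 0 := by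
    rw [Measure.measure_prod_null hS]
    refine Eventually.of_forall fun w => ?_
    change AddCircle.haarAddCircle _ = 0
    by_cases hw : ‖w‖ < r
    · refine measure_mono_null (fun x hx => ?_)
        ((hu.subharmonicDisc hU hr hw).haar_bot_eq_zero (by simpa using h0))
      exact hx.2
    · convert measure_empty (μ := AddCircle.haarAddCircle (T := 2 * Real.pi))
      refine Set.eq_empty_of_forall_notMem fun x hx => hw ?_
      have h1 : f (w, x) ∈ Metric.ball z r := hx.1
      rwa [mem_ball_iff_norm, add_sub_cancel_left, norm_smul, Circle.norm_coe, one_mul] at h1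
  rw [Measure.prod_apply_symm hS, lintegral_eq_zero_iff (measurable_measure_prodMk_right hS)] at hprod
  obtain ⟨x, hx⟩ := hprod.exists
  set c : ℂ := (AddCircle.toCircle x : ℂ) with hc
  have hc0 : c ≠ 0 := Circle.coe_ne_zero _
  let T : Cn n →ₗ[ℝ] Cn n := (LinearMap.lsmul ℂ (Cn n) c).restrictScalars ℝ
  have h1 : volume (T '' {w | z + c • w ∈ N}) = 0 := by
    rw [Measure.addHaar_image_linearMap]
    have : volume {w | z + c • w ∈ N} = 0 := hx
    rw [this, mul_zero]
  rw [← measure_preimage_add volume z N]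
  refine measure_mono_null (fun y hy => Set.mem_image _ _ _ |>.2 ⟨c⁻¹ • y, ?_, ?_⟩) h1
  · change z + c • c⁻¹ • y ∈ N
    rwa [smul_inv_smul₀ hc0]
  · change c • c⁻¹ • y = y
    rw [smul_inv_smul₀ hc0]

theorem PSHOn.exists_ball_volume_bot {u : Cn n → EReal} {U : Set (Cn n)} (hU : IsOpen U)
    (hu : PSHOn u U) {z : Cn n} (hz : z ∈ U) :
    ∃ r > 0, volume (Metric.ball z r ∩ {y | u y = ⊥}) = 0 := by
  set G : Set (Cn n) := {z | ∃ r > 0, volume (Metric.ball z r ∩ {y | u y = ⊥}) = 0} with hG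
  have hGo : IsOpen G := by
    refine Metric.isOpen_iff.2 fun y ⟨r, hr, h⟩ => ⟨r, hr, fun x hx => ?_⟩
    have hx' : dist x y < r := hx
    refine ⟨r - dist x y, by linarith, measure_mono_null (Set.inter_subset_inter_left _ ?_) h⟩
    exact Metric.ball_subset_ball' (by linarith)
  have hpc : IsPreconnected (connectedComponentIn U z) := isPreconnected_connectedComponentIn
  obtain ⟨w, hw, hwb⟩ := hu.not_botOnComponents z hz
  have hsub : connectedComponentIn U z ⊆ G := by
    refine hpc.subset_of_closure_inter_subset hGo ⟨w, hw, ?_⟩ ?_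
    · have hwU := connectedComponentIn_subset _ _ hw
      obtain ⟨ρ, hρ, hsub⟩ := Metric.isOpen_iff.1 hU w hwU
      exact ⟨ρ, hρ, hu.volume_ball_bot hU hsub hwb⟩
    · rintro x ⟨hxG, hxc⟩
      have hxU := connectedComponentIn_subset _ _ hxc
      obtain ⟨ρ, hρ, hsub⟩ := Metric.isOpen_iff.1 hU x hxU
      obtain ⟨y, hyG, hxy⟩ := Metric.mem_closure_iff.1 hxG (ρ / 2) (by linarith)
      obtain ⟨s, hs, hsy⟩ := hyG
      set t := min s (ρ / 2 - dist x y) with ht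
      have htpos : 0 < t := lt_min hs (by linarith)
      obtain ⟨p, hp, hpb⟩ : ∃ p ∈ Metric.ball y t, u p ≠ ⊥ := by
        by_contra! hcon
        have h1 : Metric.ball y t ⊆ Metric.ball y s ∩ {y | u y = ⊥} := fun q hq =>
          ⟨Metric.ball_subset_ball (min_le_left _ _) hq, hcon q hq⟩
        exact (Metric.measure_ball_pos volume y htpos).ne' (measure_mono_null h1 hsy)
      have hpx : dist x p < ρ / 2 := by
        have h1 := dist_triangle x y p
        have h2 : dist p y < t := hp
        have h3 : t ≤ ρ / 2 - dist x y := min_le_right _ _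
        rw [dist_comm] at h2
        linarith
      have hpU : Metric.ball p (ρ / 2) ⊆ U := by
        refine (Metric.ball_subset_ball' ?_).trans hsub
        rw [dist_comm]
        linarith
      have h3 := hu.volume_ball_bot hU hpU hpb
      refine ⟨ρ / 2 - dist x p, by linarith, measure_mono_null (Set.inter_subset_inter_left _ ?_) h3⟩
      exact Metric.ball_subset_ball' (by linarith)
  exact hsub (mem_connectedComponentIn hz)

theorem PSHOn.of_ball {u : Cn n → EReal} {ρ : ℝ}
    (husc : UpperSemicontinuousOn u (Metric.ball 0 ρ)) (hlt : ∀ z ∈ Metric.ball 0 ρ, u z < ⊤)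
    (hbot : ∃ p ∈ Metric.ball 0 ρ, u p ≠ ⊥)
    (hsub : ∀ z ∈ Metric.ball 0 ρ, ∀ w : Cn n, ∃ ε > 0, ∀ r : ℝ, 0 < r → r < ε →
      (∀ θ, circlePt z w r θ ∈ Metric.ball 0 ρ) → SubMean u z w r) :
    PSHOn u (Metric.ball 0 ρ) := by
  refine ⟨husc, hlt, fun z hz => ?_, fun z hz w => ?_⟩
  · rw [IsPreconnected.connectedComponentIn (convex_ball (0 : Cn n) ρ).isPreconnected hz]
    exact hbot
  · obtain ⟨ε, hε, h⟩ := hsub z hz w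
    obtain ⟨δ, hδ, h'⟩ := exists_circlePt_mem Metric.isOpen_ball hz w
    refine ⟨min ε δ, lt_min hε hδ, fun r hr hrm => ?_⟩
    have hc := h' r hr (hrm.trans_le (min_le_right _ _))
    exact (subMean_iff_circleAvg husc hlt hc).1 (h r hr (hrm.trans_le (min_le_left _ _)) hc)

theorem PSHOn.pshNear {u : Cn n → EReal} {ρ : ℝ} (hρ : 0 < ρ) (h : PSHOn u (Metric.ball 0 ρ)) :
    PSHNear u :=
  ⟨_, Metric.ball_mem_nhds _ hρ, Metric.isOpen_ball, h⟩

theorem PSHNear.exists_ball {u : Cn n → EReal} (hu : PSHNear u) :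
    ∃ R > 0, ∀ ρ, 0 < ρ → ρ ≤ R → PSHOn u (Metric.ball 0 ρ) ∧
      volume (Metric.ball 0 ρ ∩ {y | u y = ⊥}) = 0 ∧ ∃ C : ℝ, ∀ z ∈ Metric.ball 0 ρ, u z ≤ C := by
  obtain ⟨U, hU0, hU, hu⟩ := hu
  have h0 := mem_of_mem_nhds hU0
  obtain ⟨C, hC1, -⟩ := EReal.lt_iff_exists_real_btwn.1 (hu.lt_top 0 h0)
  have hev : ∀ᶠ z in 𝓝 (0 : Cn n), u z < C := by
    have := hu.usc 0 h0 C hC1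
    rwa [hU.nhdsWithin_eq h0] at this
  obtain ⟨R₁, hR₁, h1⟩ := Metric.eventually_nhds_iff_ball.1 (hev.and hU0)
  obtain ⟨R₂, hR₂, h2⟩ := hu.exists_ball_volume_bot hU h0
  refine ⟨min R₁ R₂, lt_min hR₁ hR₂, fun ρ hρ hρR => ?_⟩
  have hs1 : Metric.ball (0 : Cn n) ρ ⊆ Metric.ball 0 R₁ :=
    Metric.ball_subset_ball (hρR.trans (min_le_left _ _))
  have hs2 : Metric.ball (0 : Cn n) ρ ⊆ Metric.ball 0 R₂ :=
    Metric.ball_subset_ball (hρR.trans (min_le_right _ _))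
  have hsU : Metric.ball (0 : Cn n) ρ ⊆ U := fun z hz => (h1 z (hs1 hz)).2
  have hnull : volume (Metric.ball (0 : Cn n) ρ ∩ {y | u y = ⊥}) = 0 :=
    measure_mono_null (Set.inter_subset_inter_left _ hs2) h2
  refine ⟨PSHOn.of_ball (hu.usc.mono hsU) (fun z hz => hu.lt_top z (hsU hz)) ?_ fun z hz w => ?_,
    hnull, C, fun z hz => (h1 z (hs1 hz)).1.le⟩
  · by_contra! hcon
    refine (Metric.measure_ball_pos volume (0 : Cn n) hρ).ne' (measure_mono_null ?_ hnull)
    exact fun q hq => ⟨hq, hcon q hq⟩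
  · obtain ⟨ε, hε, h⟩ := hu.exists_subMean hU (hsU hz) w
    exact ⟨ε, hε, fun r hr hrε _ => h r hr hrε⟩

theorem upperSemicontinuousOn_affine {X : Type*} [TopologicalSpace X] {u : X → EReal} {U : Set X}
    (hu : UpperSemicontinuousOn u U) {a : ℝ} (ha : 0 < a) (b : ℝ) :
    UpperSemicontinuousOn (fun z => (a : EReal) * u z + b) U := fun x hx =>
  (continuous_affine ha b).continuousAt.comp_upperSemicontinuousWithinAt (hu x hx) (affine_mono ha b)

theorem PSHOn.max_affine {u v : Cn n → EReal} {ρ : ℝ} (hu : PSHOn u (Metric.ball 0 ρ))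
    (hv : PSHOn v (Metric.ball 0 ρ)) (hbot : ∃ p ∈ Metric.ball 0 ρ, u p ≠ ⊥)
    {a : ℝ} (ha : 0 < a) (b : ℝ) :
    PSHOn (fun z => max (u z) ((a : EReal) * v z + b)) (Metric.ball 0 ρ) := by
  have husc := upperSemicontinuousOn_affine hv.usc ha b
  refine PSHOn.of_ball (hu.usc.sup husc)
    (fun z hz => max_lt (hu.lt_top z hz) (affine_lt_top ha b (hv.lt_top z hz))) ?_ fun z hz w => ?_
  · obtain ⟨p, hp, hpb⟩ := hbot
    refine ⟨p, hp, ?_⟩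
    exact ((bot_lt_iff_ne_bot.2 hpb).trans_le (le_max_left _ _)).ne'
  · obtain ⟨ε, hε, h⟩ := hu.exists_subMean Metric.isOpen_ball hz w
    obtain ⟨δ, hδ, h'⟩ := hv.exists_subMean Metric.isOpen_ball hz w
    refine ⟨min ε δ, lt_min hε hδ, fun r hr hrm hc => ?_⟩
    exact SubMean.max hu.usc husc hu.lt_top (fun z hz => affine_lt_top ha b (hv.lt_top z hz)) hc
      (h r hr (hrm.trans_le (min_le_left _ _)))
      ((h' r hr (hrm.trans_le (min_le_right _ _))).affine hv.usc hv.lt_top hc ha b)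

/-- The function `x ↦ e^{-2x}` on `EReal`. -/
def expNegTwo (x : EReal) : ℝ≥0∞ := expE (((-2 : ℝ) : EReal) * x)

@[simp] theorem expNegTwo_bot : expNegTwo ⊥ = ⊤ := by
  rw [expNegTwo, EReal.coe_mul_bot_of_neg (by norm_num)]
  simp [expE]

@[simp] theorem expNegTwo_top : expNegTwo ⊤ = 0 := by
  rw [expNegTwo, EReal.coe_mul_top_of_neg (by norm_num)]
  simp [expE]

@[simp] theorem expNegTwo_coe (x : ℝ) :
    expNegTwo x = ENNReal.ofReal (Real.exp (-2 * x)) := by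
  rw [expNegTwo, expE, ← EReal.coe_mul]
  simp only [EReal.coe_ne_bot, EReal.coe_ne_top, if_false, EReal.toReal_coe]

theorem expNegTwo_antitone : Antitone expNegTwo := by
  intro x y hxy
  induction x with
  | bot => simp
  | top => rw [top_le_iff.1 hxy]
  | coe x =>
    induction y with
    | bot => simp at hxy
    | top => simp
    | coe y =>
      rw [expNegTwo_coe, expNegTwo_coe]
      have : x ≤ y := by exact_mod_cast hxy
      gcongr ENNReal.ofReal (Real.exp ?_)
      linarith

theorem expNegTwo_add_coe (x : EReal) (c : ℝ) :
    expNegTwo (x + c) = ENNReal.ofReal (Real.exp (-2 * c)) * expNegTwo x := by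
  induction x with
  | bot => simp [ENNReal.mul_top, Real.exp_pos]
  | top => simp
  | coe x =>
    rw [← EReal.coe_add, expNegTwo_coe, expNegTwo_coe, ← ENNReal.ofReal_mul (Real.exp_pos _).le,
      ← Real.exp_add]
    ring_nf

theorem iSup_expNegTwo_max (x : EReal) :
    ⨆ j : ℕ, expNegTwo (max x ((-(j : ℝ) : ℝ) : EReal)) = expNegTwo x := by
  refine le_antisymm (iSup_le fun j => expNegTwo_antitone (le_max_left _ _)) ?_
  induction x with
  | top => simp
  | coe x =>
    obtain ⟨j, hj⟩ := exists_nat_ge (-x)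
    refine le_iSup_of_le j (expNegTwo_antitone (max_le le_rfl ?_))
    exact_mod_cast (by linarith : -(j : ℝ) ≤ x)
  | bot =>
    rw [expNegTwo_bot, top_le_iff, iSup_eq_top]
    intro b hb
    obtain ⟨j, hj⟩ := exists_nat_gt b.toReal
    refine ⟨j, ?_⟩
    rw [max_eq_right bot_le, expNegTwo_coe, ENNReal.lt_ofReal_iff_toReal_lt hb.ne]
    have := Real.add_one_le_exp (-2 * -(j : ℝ))
    have hj0 : (0 : ℝ) ≤ j := by positivity
    linarith

theorem wexp_neg_two (φ : Cn n → EReal) (z : Cn n) : wexp (-2) φ z = expNegTwo (φ z) := rfl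

theorem aemeasurable_restrict_of_upperSemicontinuousOn {u : Cn n → EReal} {U : Set (Cn n)}
    (hU : MeasurableSet U) (hu : UpperSemicontinuousOn u U) :
    AEMeasurable u (volume.restrict U) :=
  aemeasurable_restrict_of_measurable_subtype hU (measurable_restrict_of_upperSemicontinuousOn hu)

theorem HoloNear.eventually_ball {f : Cn n → ℂ} (hf : HoloNear f) :
    ∃ R > 0, DifferentiableOn ℂ f (Metric.ball 0 R) := by
  obtain ⟨U, hU0, _, h⟩ := hf
  obtain ⟨R, hR, hsub⟩ := Metric.mem_nhds_iff.1 hU0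
  exact ⟨R, hR, h.mono hsub⟩

theorem aemeasurable_dens0 {m : ℕ} {f₀ : Fin m → Cn n → ℂ} {φ₀ : Cn n → EReal}
    (hf : ∀ j, HoloNear (f₀ j)) (hφ : PSHNear φ₀) :
    ∃ R > 0, AEMeasurable (dens0 f₀ φ₀) (volume.restrict (Metric.ball 0 R)) := by
  obtain ⟨R, hR, h⟩ := hφ.exists_ball
  have hev : ∀ᶠ ρ in 𝓝[>] (0 : ℝ), ∀ j, DifferentiableOn ℂ (f₀ j) (Metric.ball 0 ρ) := by
    refine eventually_all.2 fun j => ?_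
    obtain ⟨R', hR', hd⟩ := (hf j).eventually_ball
    filter_upwards [Ioo_mem_nhdsGT hR'] with ρ hρ
    exact hd.mono (Metric.ball_subset_ball hρ.2.le)
  obtain ⟨ρ, hρ, hd⟩ := (Eventually.and (Ioo_mem_nhdsGT hR) hev).exists
  refine ⟨ρ, hρ.1, ?_⟩
  have h1 : AEMeasurable (wexp (-2) φ₀) (volume.restrict (Metric.ball 0 ρ)) :=
    expNegTwo_antitone.measurable.comp_aemeasurable
      (aemeasurable_restrict_of_upperSemicontinuousOn measurableSet_ball
        (h ρ hρ.1 hρ.2.le).1.usc)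
  have h2 : AEMeasurable (normSq2 f₀) (volume.restrict (Metric.ball 0 ρ)) := by
    unfold normSq2
    refine Finset.aemeasurable_fun_sum _ fun j _ => ?_
    have := (hd j).continuousOn.aemeasurable (μ := volume) measurableSet_ball
    exact this.nnnorm.coe_nnreal_ennreal.pow_const 2
  exact h2.mul h1

theorem IntNear.exists_ball {g : Cn n → ℝ≥0∞} (h : IntNear g) :
    ∃ R > 0, ∀ ρ ≤ R, ∫⁻ z in Metric.ball 0 ρ, g z < ⊤ := by
  obtain ⟨U, hU, h⟩ := h
  obtain ⟨R, hR, hsub⟩ := Metric.mem_nhds_iff.1 hU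
  refine ⟨R, hR, fun ρ hρ => (lintegral_mono_set ?_).trans_lt h⟩
  exact (Metric.ball_subset_ball hρ).trans hsub

theorem IntNear.mono_ae {g h : Cn n → ℝ≥0∞} (hg : IntNear g) {ρ : ℝ} (hρ : 0 < ρ)
    (hle : ∀ᵐ z ∂volume.restrict (Metric.ball 0 ρ), h z ≤ g z) : IntNear h := by
  obtain ⟨R, hR, hfin⟩ := hg.exists_ball
  refine ⟨Metric.ball 0 (min R ρ), Metric.ball_mem_nhds _ (lt_min hR hρ), ?_⟩
  refine (lintegral_mono_ae ?_).trans_lt (hfin _ (min_le_left _ _))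
  exact ae_restrict_of_ae_restrict_of_subset (Metric.ball_subset_ball (min_le_right _ _)) hle

theorem IntNear.mono {g h : Cn n → ℝ≥0∞} (hg : IntNear g)
    (hle : ∀ᶠ z in 𝓝 (0 : Cn n), h z ≤ g z) : IntNear h := by
  obtain ⟨ρ, hρ, hb⟩ := Metric.eventually_nhds_iff_ball.1 hle
  exact hg.mono_ae hρ (ae_restrict_of_forall_mem measurableSet_ball hb)

theorem IntNear.const_mul {g : Cn n → ℝ≥0∞} (hg : IntNear g) {c : ℝ≥0∞} (hc : c ≠ ⊤) :
    IntNear fun z => c * g z := by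
  obtain ⟨U, hU, h⟩ := hg
  refine ⟨U, hU, ?_⟩
  rw [lintegral_const_mul' _ _ hc]
  exact ENNReal.mul_lt_top hc.lt_top h

theorem leO.intNear {W : Cn n → ℝ≥0∞} {φ φ' : Cn n → EReal} (h : leO φ φ')
    (hInt : IntNear fun z => W z * wexp (-2) φ z) : IntNear fun z => W z * wexp (-2) φ' z := by
  obtain ⟨C, hC⟩ := h
  refine (hInt.const_mul (c := ENNReal.ofReal (Real.exp (2 * C))) ENNReal.ofReal_ne_top).mono ?_
  filter_upwards [hC] with z hz
  have h1 := expNegTwo_antitone hz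
  rw [expNegTwo_add_coe] at h1
  have h2 : expNegTwo (φ' z) ≤ ENNReal.ofReal (Real.exp (2 * C)) * expNegTwo (φ z) := by
    calc expNegTwo (φ' z) = ENNReal.ofReal (Real.exp (2 * C)) *
          (ENNReal.ofReal (Real.exp (-2 * C)) * expNegTwo (φ' z)) := by
          rw [← mul_assoc, ← ENNReal.ofReal_mul (Real.exp_pos _).le, ← Real.exp_add]
          simp
      _ ≤ _ := by gcongr
  rw [wexp_neg_two, wexp_neg_two, mul_left_comm]
  gcongr

theorem PSHNear.exists_bound {u : Cn n → EReal} (hu : PSHNear u) :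
    ∃ C : ℝ, ∀ᶠ z in 𝓝 (0 : Cn n), u z ≤ C := by
  obtain ⟨R, hR, h⟩ := hu.exists_ball
  obtain ⟨-, -, C, hC⟩ := h R hR le_rfl
  exact ⟨C, eventually_of_mem (Metric.ball_mem_nhds _ hR) hC⟩

theorem leO_zero_mul {ψ Φ : Cn n → EReal} (hψ : ∃ C : ℝ, ∀ᶠ z in 𝓝 (0 : Cn n), ψ z ≤ C) :
    leO ψ fun z => ((0 : ℝ) : EReal) * Φ z := by
  obtain ⟨C, hC⟩ := hψ
  exact ⟨C, by simpa using hC⟩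

/-- Transfer of an upper bound `y ≤ b x + c` through an affine map. -/
theorem affine_le_of_le_mul_add {a b c d : ℝ} (ha : 0 < a) {x y : EReal}
    (h : y ≤ (b : EReal) * x + c) :
    (a : EReal) * y + d ≤ ((a * b : ℝ) : EReal) * x + ((a * c + d : ℝ) : EReal) := by
  refine (affine_mono ha d h).trans (le_of_eq ?_)
  simp only
  rw [EReal.coe_mul, EReal.coe_add, EReal.coe_mul, mul_assoc,
    EReal.left_distrib_of_nonneg_of_ne_top (by exact_mod_cast ha.le) (EReal.coe_ne_top _), add_assoc]

theorem mul_le_mul_add_of_le {b b' C : ℝ} (hb' : 0 ≤ b') (hbb : b' ≤ b) (hC : 0 ≤ C) {x : EReal}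
    (hx : x ≤ C) : (b : EReal) * x ≤ (b' : EReal) * x + ((b * C : ℝ) : EReal) := by
  induction x with
  | bot =>
    rcases hb'.eq_or_lt with rfl | hb0
    · rcases hbb.eq_or_lt with rfl | hb1
      · simp
      · simp [EReal.coe_mul_bot_of_pos hb1]
    · simp [EReal.coe_mul_bot_of_pos (hb0.trans_le hbb)]
  | top => simp at hx
  | coe x =>
    have hx : x ≤ C := by exact_mod_cast hx
    have : b * x ≤ b' * x + b * C := by nlinarith
    exact_mod_cast this

theorem leO_mul_of_le {ψ Φ : Cn n → EReal} (hΦ : ∃ C : ℝ, ∀ᶠ z in 𝓝 (0 : Cn n), Φ z ≤ C)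
    {b b' : ℝ} (hb' : 0 ≤ b') (hbb : b' ≤ b) (h : leO ψ fun z => (b : EReal) * Φ z) :
    leO ψ fun z => (b' : EReal) * Φ z := by
  obtain ⟨C, hC⟩ := hΦ
  obtain ⟨D, hD⟩ := h
  refine ⟨b * max C 0 + D, ?_⟩
  filter_upwards [hC, hD] with z hz hz'
  have h1 : Φ z ≤ (max C 0 : ℝ) := hz.trans (by exact_mod_cast le_max_left _ _)
  rw [EReal.coe_add, ← add_assoc]
  exact hz'.trans (add_le_add_left (mul_le_mul_add_of_le hb' hbb (le_max_right _ _) h1) _)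

theorem exists_seq_of_step {α : Type*} {Inv : α → Prop} {Rel : ℕ → α → α → Prop} {a₀ : α}
    (h₀ : Inv a₀) (step : ∀ k a, Inv a → ∃ a', Inv a' ∧ Rel k a a') :
    ∃ s : ℕ → α, s 0 = a₀ ∧ ∀ k, Inv (s k) ∧ Rel k (s k) (s (k + 1)) := by
  have : Nonempty α := ⟨a₀⟩
  choose! f hf using step
  let s : ℕ → α := fun k => Nat.rec a₀ (fun k a => f k a) k
  have hs : ∀ k, Inv (s k) := by
    intro k
    induction k with
    | zero => exact h₀
    | succ k ih => exact (hf k _ ih).1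
  exact ⟨s, rfl, fun k => ⟨hs k, (hf k _ (hs k)).2⟩⟩

theorem exists_nat_lt_lintegral_truncation {W : Cn n → ℝ≥0∞} {φ : Cn n → EReal} {μ : Measure (Cn n)}
    (hW : AEMeasurable W μ) (hφ : AEMeasurable φ μ)
    (h : ∫⁻ z, W z * expNegTwo (φ z) ∂μ = ⊤) (k : ℕ) :
    ∃ j : ℕ, (k : ℝ≥0∞) < ∫⁻ z, W z * expNegTwo (max (φ z) ((-(j : ℝ) : ℝ) : EReal)) ∂μ := by
  have h1 : ∫⁻ z, ⨆ j : ℕ, W z * expNegTwo (max (φ z) ((-(j : ℝ) : ℝ) : EReal)) ∂μ = ⊤ := by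
    rw [← h]
    simp_rw [← ENNReal.mul_iSup, iSup_expNegTwo_max]
  rw [lintegral_iSup'] at h1
  · exact iSup_eq_top.1 h1 k (ENNReal.natCast_lt_top k)
  · intro j
    exact hW.mul (expNegTwo_antitone.measurable.comp_aemeasurable (hφ.max aemeasurable_const))
  · refine Eventually.of_forall fun z i j hij => ?_
    refine mul_le_mul_right (expNegTwo_antitone (max_le_max le_rfl ?_)) _
    have : (i : ℝ) ≤ j := by exact_mod_cast hij
    exact_mod_cast (by linarith : -(j : ℝ) ≤ -(i : ℝ))

theorem IsZhouWeightFor.exists_lt_of_ae {W : Cn n → ℝ≥0∞} {Φ : Cn n → EReal}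
    (hΦ : IsZhouWeightFor W Φ) (hW : IntNear W) {ρ : ℝ} (hρ : 0 < ρ) {P : Cn n → Prop}
    (hP : ∀ᵐ z ∂volume.restrict (Metric.ball 0 ρ), P z) (M : ℝ) :
    ∃ z ∈ Metric.ball 0 ρ, Φ z < (-M : ℝ) ∧ P z := by
  by_contra! hcon
  refine hΦ.nonint ((hW.const_mul (c := expNegTwo (-M : ℝ)) (by rw [expNegTwo_coe]; simp)).mono_ae hρ ?_)
  filter_upwards [hP, ae_restrict_mem measurableSet_ball] with z hz hzb
  rw [wexp_neg_two, mul_comm]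
  refine mul_le_mul_left (expNegTwo_antitone ?_) _
  by_contra! hlt
  exact hcon z hzb hlt hz

/-- Properties kept along the construction of an increasing sequence of competitors of `Φ` on
a ball: the sub-mean value inequality holds on every circle on which it holds for `Φ` and `ψ`. -/
structure CompetitorOn (Φ ψ : Cn n → EReal) (ρ : ℝ) (φ : Cn n → EReal) : Prop where
  usc : UpperSemicontinuousOn φ (Metric.ball 0 ρ)
  lt_top : ∀ z ∈ Metric.ball 0 ρ, φ z < ⊤
  subMean : ∀ z w r, (∀ θ, circlePt z w r θ ∈ Metric.ball 0 ρ) → SubMean Φ z w r →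
    SubMean ψ z w r → SubMean φ z w r
  le : ∀ z ∈ Metric.ball 0 ρ, Φ z ≤ φ z
  leO : leO φ Φ

theorem CompetitorOn.max_affine {Φ ψ φ : Cn n → EReal} {ρ : ℝ} (h : CompetitorOn Φ ψ ρ φ)
    (hψ : PSHOn ψ (Metric.ball 0 ρ)) (hle : ∀ b : ℝ, 0 ≤ b → _root_.leO ψ fun z => (b : EReal) * Φ z)
    {ε : ℝ} (hε : 0 < ε) (b : ℝ) :
    CompetitorOn Φ ψ ρ fun z => max (φ z) ((ε : EReal) * ψ z + b) := by
  have husc := upperSemicontinuousOn_affine hψ.usc hε b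
  have hlt : ∀ z ∈ Metric.ball 0 ρ, (ε : EReal) * ψ z + b < ⊤ := fun z hz =>
    affine_lt_top hε b (hψ.lt_top z hz)
  refine ⟨h.usc.sup husc, fun z hz => max_lt (h.lt_top z hz) (hlt z hz), ?_,
    fun z hz => (h.le z hz).trans (le_max_left _ _), ?_⟩
  · intro z w r hc h1 h2
    exact SubMean.max h.usc husc h.lt_top hlt hc (h.subMean z w r hc h1 h2)
      (h2.affine hψ.usc hψ.lt_top hc hε b)
  · obtain ⟨C, hC⟩ := h.leO
    obtain ⟨D, hD⟩ := hle ε⁻¹ (by positivity)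
    refine ⟨max C (ε * D + b), ?_⟩
    filter_upwards [hC, hD] with z hz hz'
    refine max_le (hz.trans (add_le_add_right ?_ _))
      ((affine_le_of_le_mul_add (d := b) hε hz').trans ?_)
    · exact_mod_cast le_max_left _ _
    · rw [mul_inv_cancel₀ hε.ne', EReal.coe_one, one_mul]
      refine add_le_add_right ?_ _
      exact_mod_cast le_max_right _ _

theorem CompetitorOn.step {W : Cn n → ℝ≥0∞} {Φ ψ : Cn n → EReal} (hΦ : IsZhouWeightFor W Φ)
    (hW : IntNear W) {ρ : ℝ} (hρ : 0 < ρ)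
    (hWm : AEMeasurable W (volume.restrict (Metric.ball 0 ρ)))
    (hψ : PSHOn ψ (Metric.ball 0 ρ)) (hψ0 : volume (Metric.ball 0 ρ ∩ {y | ψ y = ⊥}) = 0)
    {C : ℝ} (hC : ∀ z ∈ Metric.ball 0 ρ, ψ z ≤ C)
    (hle : ∀ b : ℝ, 0 ≤ b → _root_.leO ψ fun z => (b : EReal) * Φ z)
    (k : ℕ) {φ : Cn n → EReal} (h : CompetitorOn Φ ψ ρ φ) (A₀ : ℝ) :
    ∃ (φ' : Cn n → EReal) (A : ℝ), CompetitorOn Φ ψ ρ φ' ∧ A₀ ≤ A ∧ k ≤ A ∧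
      (∀ z, φ z ≤ φ' z) ∧
      (∀ z ∈ Metric.ball 0 ρ, φ' z ≤ max (φ z) ((-A : ℝ) : EReal)) ∧
      (k : ℝ≥0∞) ≤ ∫⁻ z in Metric.ball 0 (min ρ (1 / (k + 1))),
        W z * expNegTwo (max (φ z) ((-A : ℝ) : EReal)) ∧
      ∃ z ∈ Metric.ball 0 (min ρ (1 / (k + 1))), Φ z < ((-(A + k + 1) : ℝ) : EReal) ∧
        ((-(A + 1) : ℝ) : EReal) ≤ φ' z := by
  set δ : ℝ := min ρ (1 / (k + 1)) with hδ
  have hδ0 : 0 < δ := lt_min hρ (by positivity)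
  have hsub : Metric.ball (0 : Cn n) δ ⊆ Metric.ball 0 ρ := Metric.ball_subset_ball (min_le_left _ _)
  have htop : ∫⁻ z in Metric.ball 0 δ, W z * expNegTwo (φ z) = ⊤ := by
    by_contra hne
    refine hΦ.nonint (h.leO.intNear ⟨_, Metric.ball_mem_nhds 0 hδ0, lt_top_iff_ne_top.2 hne⟩)
  obtain ⟨j, hj⟩ := exists_nat_lt_lintegral_truncation
    (hWm.mono_measure (Measure.restrict_mono hsub le_rfl))
    (aemeasurable_restrict_of_upperSemicontinuousOn measurableSet_ball (h.usc.mono hsub)) htop k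
  set A : ℝ := max j (max k A₀) with hA
  have hjA : (j : ℝ) ≤ A := le_max_left _ _
  have hkA : (k : ℝ) ≤ A := (le_max_left _ _).trans (le_max_right _ _)
  have hA₀ : A₀ ≤ A := (le_max_right _ _).trans (le_max_right _ _)
  have hae : ∀ᵐ z ∂volume.restrict (Metric.ball 0 δ), ψ z ≠ ⊥ := by
    rw [ae_restrict_iff' measurableSet_ball, ae_iff]
    refine measure_mono_null (fun z hz => ?_) hψ0
    have hz : ¬ (z ∈ Metric.ball 0 δ → ψ z ≠ ⊥) := hz
    push Not at hz
    exact ⟨hsub hz.1, hz.2⟩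
  obtain ⟨z, hzb, hzΦ, hzψ⟩ := hΦ.exists_lt_of_ae hW hδ0 hae (A + k + 1)
  have hzC := hC z (hsub hzb)
  have hzt := hψ.lt_top z (hsub hzb)
  obtain ⟨p, hp⟩ : ∃ p : ℝ, ψ z = p := ⟨(ψ z).toReal, (EReal.coe_toReal hzt.ne hzψ).symm⟩
  have hpC : p ≤ C := by rw [hp] at hzC; exact_mod_cast hzC
  set ε : ℝ := (1 + (C - p))⁻¹ with hε
  have hden : 0 < 1 + (C - p) := by linarith
  have hε0 : 0 < ε := inv_pos.2 hden
  have hεp : ε * (1 + (C - p)) = 1 := inv_mul_cancel₀ hden.ne'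
  refine ⟨fun z => max (φ z) ((ε : EReal) * ψ z + ((-A - ε * C : ℝ) : EReal)), A,
    h.max_affine hψ hle hε0 _, hA₀, hkA, fun z => le_max_left _ _, fun z hz => ?_, ?_,
    z, hzb, hzΦ, ?_⟩
  · refine max_le_max le_rfl ((affine_mono hε0 _ (hC z hz)).trans (le_of_eq ?_))
    simp only
    rw [← EReal.coe_mul, ← EReal.coe_add]
    congr 1
    ring
  · refine hj.le.trans (lintegral_mono fun z => mul_le_mul_right (expNegTwo_antitone ?_) _)
    exact max_le_max le_rfl (by exact_mod_cast neg_le_neg hjA)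
  · refine le_max_of_le_right ?_
    rw [hp, ← EReal.coe_mul, ← EReal.coe_add, EReal.coe_le_coe_iff]
    nlinarith

theorem IsZhouWeightFor.bddAbove {W : Cn n → ℝ≥0∞} {Φ ψ : Cn n → EReal}
    (hΦ : IsZhouWeightFor W Φ) (hW : IntNear W)
    (hWm : ∃ R > 0, AEMeasurable W (volume.restrict (Metric.ball 0 R))) (hψ : PSHNear ψ) :
    BddAbove {b : ℝ | 0 ≤ b ∧ leO ψ fun z => (b : EReal) * Φ z} := by
  by_contra hunb
  have hle : ∀ b : ℝ, 0 ≤ b → leO ψ fun z => (b : EReal) * Φ z := by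
    intro b hb
    obtain ⟨b', hb', hlt⟩ := not_bddAbove_iff.1 hunb b
    exact leO_mul_of_le hΦ.psh.exists_bound hb hlt.le hb'.2
  obtain ⟨R₁, hR₁, hWm⟩ := hWm
  obtain ⟨R₂, hR₂, hB₂⟩ := hΦ.psh.exists_ball
  obtain ⟨R₃, hR₃, hB₃⟩ := hψ.exists_ball
  set ρ := min R₁ (min R₂ R₃) with hρd
  have hρ : 0 < ρ := lt_min hR₁ (lt_min hR₂ hR₃)
  have hWm := hWm.mono_measure
    (Measure.restrict_mono (Metric.ball_subset_ball (min_le_left R₁ (min R₂ R₃))) le_rfl)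
  obtain ⟨hΦB, -, -⟩ := hB₂ ρ hρ ((min_le_right _ _).trans (min_le_left _ _))
  obtain ⟨hψB, hψ0, C, hC⟩ := hB₃ ρ hρ ((min_le_right _ _).trans (min_le_right _ _))
  have h₀ : CompetitorOn Φ ψ ρ Φ :=
    ⟨hΦB.usc, hΦB.lt_top, fun _ _ _ _ h _ => h, fun _ _ => le_rfl, 0, by simp⟩
  obtain ⟨s, -, hs⟩ := exists_seq_of_step (α := (Cn n → EReal) × ℝ)
    (Inv := fun a => CompetitorOn Φ ψ ρ a.1)
    (Rel := fun k a a' => a.2 ≤ a'.2 ∧ k ≤ a'.2 ∧ (∀ z, a.1 z ≤ a'.1 z) ∧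
      (∀ z ∈ Metric.ball 0 ρ, a'.1 z ≤ max (a.1 z) ((-a'.2 : ℝ) : EReal)) ∧
      (k : ℝ≥0∞) ≤ ∫⁻ z in Metric.ball 0 (min ρ (1 / (k + 1))),
        W z * expNegTwo (max (a.1 z) ((-a'.2 : ℝ) : EReal)) ∧
      ∃ z ∈ Metric.ball 0 (min ρ (1 / (k + 1))), Φ z < ((-(a'.2 + k + 1) : ℝ) : EReal) ∧
        ((-(a'.2 + 1) : ℝ) : EReal) ≤ a'.1 z) (a₀ := (Φ, 0)) h₀
    (fun k a ha => by
      obtain ⟨φ', A, h1, h2⟩ := ha.step hΦ hW hρ hWm hψB hψ0 hC hle k a.2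
      exact ⟨(φ', A), h1, h2⟩)
  have hmono : ∀ z, Monotone fun k => (s k).1 z := fun z =>
    monotone_nat_of_le_succ fun k => (hs k).2.2.2.1 z
  have hAmono : Monotone fun k => (s k).2 := monotone_nat_of_le_succ fun k => (hs k).2.1
  have hub : ∀ k j, ∀ z ∈ Metric.ball 0 ρ,
      (s (k + j)).1 z ≤ max ((s k).1 z) ((-(s (k + 1)).2 : ℝ) : EReal) := by
    intro k j z hz
    induction j with
    | zero => exact le_max_left _ _
    | succ j ih =>
      refine ((hs (k + j)).2.2.2.2.1 z hz).trans (max_le ih (le_max_of_le_right ?_))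
      have : (s (k + 1)).2 ≤ (s (k + j + 1)).2 := hAmono (by omega)
      exact_mod_cast neg_le_neg this
  set φ' : Cn n → EReal := fun z => ⨆ k, (s k).1 z with hφ'
  have hle' : ∀ k z, (s k).1 z ≤ φ' z := fun k z => le_iSup (fun k => (s k).1 z) k
  have hub' : ∀ k, ∀ z ∈ Metric.ball 0 ρ,
      φ' z ≤ max ((s k).1 z) ((-(s (k + 1)).2 : ℝ) : EReal) := by
    intro k z hz
    refine iSup_le fun j => ?_
    exact (hmono z (Nat.le_add_left j k)).trans (hub k j z hz)
  have husc : UpperSemicontinuousOn φ' (Metric.ball 0 ρ) := by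
    intro x hx a ha
    obtain ⟨y, -, hya⟩ := EReal.lt_iff_exists_real_btwn.1 (bot_le.trans_lt ha)
    obtain ⟨k, hk⟩ := exists_nat_ge (-y)
    have h1 : ((-(s (k + 1)).2 : ℝ) : EReal) < a := by
      refine lt_of_le_of_lt ?_ hya
      have := (hs k).2.2.1
      exact_mod_cast (by linarith : -(s (k + 1)).2 ≤ y)
    filter_upwards [(hs k).1.usc x hx a ((hle' k x).trans_lt ha), self_mem_nhdsWithin] with q hq hqB
    exact (hub' k q hqB).trans_lt (max_lt hq h1)
  have hlt : ∀ z ∈ Metric.ball 0 ρ, φ' z < ⊤ := fun z hz =>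
    (hub' 0 z hz).trans_lt (max_lt ((hs 0).1.lt_top z hz) (EReal.coe_lt_top _))
  have hΦφ : ∀ z ∈ Metric.ball 0 ρ, Φ z ≤ φ' z := fun z hz => ((hs 0).1.le z hz).trans (hle' 0 z)
  have hpsh : PSHOn φ' (Metric.ball 0 ρ) := by
    refine PSHOn.of_ball husc hlt ?_ fun z hz w => ?_
    · obtain ⟨p, hp, hpb⟩ := hΦB.not_botOnComponents 0 (Metric.mem_ball_self hρ)
      have hpB := connectedComponentIn_subset _ _ hp
      exact ⟨p, hpB, ((bot_lt_iff_ne_bot.2 hpb).trans_le (hΦφ p hpB)).ne'⟩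
    · obtain ⟨ε, hε, h1⟩ := hΦB.exists_subMean Metric.isOpen_ball hz w
      obtain ⟨ε', hε', h2⟩ := hψB.exists_subMean Metric.isOpen_ball hz w
      refine ⟨min ε ε', lt_min hε hε', fun r hr hrm hc M => iSup_le fun k => ?_⟩
      exact ((hs k).1.subMean z w r hc (h1 r hr (hrm.trans_le (min_le_left _ _)))
        (h2 r hr (hrm.trans_le (min_le_right _ _)))).mono (hs k).1.usc husc hlt
        (fun z _ => hle' k z) hc M
  have hnon : ¬ IntNear fun z => W z * wexp (-2) φ' z := by
    intro hInt
    obtain ⟨r, hr, hfin⟩ := hInt.exists_ball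
    have hfin := hfin r le_rfl
    obtain ⟨N, hN⟩ := ENNReal.exists_nat_gt hfin.ne
    obtain ⟨K, hK⟩ := exists_nat_one_div_lt hr
    set k := max N K with hk
    have hkr : min ρ (1 / ((k : ℝ) + 1)) ≤ r := by
      refine (min_le_right _ _).trans (le_trans ?_ hK.le)
      have : (K : ℝ) ≤ k := by exact_mod_cast le_max_right N K
      gcongr
    refine absurd ((hs k).2.2.2.2.2.1.trans ?_) (not_le.2 (hN.trans_le
      (by exact_mod_cast le_max_left N K : (N : ℝ≥0∞) ≤ k)))
    refine (setLIntegral_mono' measurableSet_ball fun z hz => ?_).trans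
      (lintegral_mono_set (Metric.ball_subset_ball hkr))
    exact mul_le_mul_right (expNegTwo_antitone
      (hub' k z (Metric.ball_subset_ball (min_le_left _ _) hz))) _
  obtain ⟨⟨D, hD⟩, -⟩ := hΦ.maximal φ' (hpsh.pshNear hρ)
    ⟨0, by
      filter_upwards [Metric.ball_mem_nhds 0 hρ] with z hz
      simpa using hΦφ z hz⟩ hnon
  obtain ⟨δ, hδ, hball⟩ := Metric.eventually_nhds_iff_ball.1 hD
  obtain ⟨N, hN⟩ := exists_nat_gt D
  obtain ⟨K, hK⟩ := exists_nat_one_div_lt hδ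
  set k := max N K with hk
  obtain ⟨z, hz, hz1, hz2⟩ := (hs k).2.2.2.2.2.2
  have hkδ : min ρ (1 / ((k : ℝ) + 1)) ≤ δ := by
    refine (min_le_right _ _).trans (le_trans ?_ hK.le)
    have : (K : ℝ) ≤ k := by exact_mod_cast le_max_right N K
    gcongr
  have hkD : D ≤ k := hN.le.trans (by exact_mod_cast le_max_left N K)
  have h1 := hball z (Metric.ball_subset_ball hkδ hz)
  have h2 : ((-((s (k + 1)).2 + 1) : ℝ) : EReal)
      < ((-((s (k + 1)).2 + k + 1) : ℝ) : EReal) + (D : EReal) :=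
    ((hz2.trans (hle' (k + 1) z)).trans h1).trans_lt (EReal.add_lt_add_right_coe hz1 D)
  rw [← EReal.coe_add, EReal.coe_lt_coe_iff] at h2
  linarith

theorem elog_eq_log_ofReal (x : ℝ) : elog x = ENNReal.log (ENNReal.ofReal x) := by
  rw [ENNReal.log_ofReal, elog]

theorem elog_mono : Monotone elog := fun x y hxy => by
  rw [elog_eq_log_ofReal, elog_eq_log_ofReal]
  exact ENNReal.log_monotone (ENNReal.ofReal_le_ofReal hxy)

theorem elog_lt_top (x : ℝ) : elog x < ⊤ := by
  unfold elog
  split_ifs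
  · exact bot_lt_top
  · exact EReal.coe_lt_top _

theorem logAbs_eq_bot_iff {f : Cn n → ℂ} {z : Cn n} : logAbs f z = ⊥ ↔ f z = 0 := by
  unfold logAbs elog
  split_ifs with h <;> simpa using h

theorem logAbs_of_ne_zero {f : Cn n → ℂ} {z : Cn n} (h : f z ≠ 0) :
    logAbs f z = (Real.log ‖f z‖ : ℝ) := by
  unfold logAbs elog
  rw [if_neg (by simpa using h)]

theorem subMean_logAbs {f : Cn n → ℂ} {B : Set (Cn n)} (hB : IsOpen B)
    (hf : DifferentiableOn ℂ f B) {z : Cn n} (hz : z ∈ B) (w : Cn n) :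
    ∃ ε > 0, ∀ r : ℝ, 0 < r → r < ε → SubMean (logAbs f) z w r := by
  by_cases h0 : f z = 0
  · refine ⟨1, one_pos, fun r _ _ M => ?_⟩
    rw [logAbs_eq_bot_iff.2 h0]
    exact bot_le
  have hO : IsOpen (B ∩ f ⁻¹' {0}ᶜ) := hf.continuousOn.isOpen_inter_preimage hB isOpen_compl_singleton
  let γ : ℂ → Cn n := fun ζ => z + ζ • w
  have hγ : Differentiable ℂ γ := by fun_prop
  have hO' : IsOpen (γ ⁻¹' (B ∩ f ⁻¹' {0}ᶜ)) := hO.preimage hγ.continuous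
  obtain ⟨ε, hε, hsub⟩ := Metric.isOpen_iff.1 hO' 0 (by simpa [γ] using ⟨hz, h0⟩)
  refine ⟨ε, hε, fun r hr hrε M => ?_⟩
  have hcl : Metric.closedBall (0 : ℂ) |r| ⊆ γ ⁻¹' (B ∩ f ⁻¹' {0}ᶜ) := by
    rw [abs_of_pos hr]
    exact (Metric.closedBall_subset_ball hrε).trans hsub
  have hd : DifferentiableOn ℂ (f ∘ γ) (γ ⁻¹' (B ∩ f ⁻¹' {0}ᶜ)) :=
    hf.comp hγ.differentiableOn fun ζ hζ => hζ.1
  have han : AnalyticOnNhd ℂ (f ∘ γ) (Metric.closedBall 0 |r|) := fun ζ hζ =>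
    hd.analyticAt (hO'.mem_nhds (hcl hζ))
  have havg := han.circleAverage_log_norm_of_ne_zero fun ζ hζ => (hcl hζ).2
  rw [Real.circleAverage_def, smul_eq_mul] at havg
  have hmem : ∀ θ, circleMap 0 r θ ∈ γ ⁻¹' (B ∩ f ⁻¹' {0}ᶜ) := fun θ =>
    hcl (by simp)
  have hcirc : ∀ θ, circlePt z w r θ = γ (circleMap 0 r θ) := fun θ => by
    simp [γ, circlePt, circleMap, mul_comm Complex.I]
  have hq : Continuous fun θ => Real.log ‖(f ∘ γ) (circleMap 0 r θ)‖ := by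
    refine Continuous.log ?_ fun θ => by simpa using (hmem θ).2
    exact (hd.continuousOn.comp_continuous (continuous_circleMap 0 r) hmem).norm
  have heq : ∀ θ, logAbs f (circlePt z w r θ)
      = (Real.log ‖(f ∘ γ) (circleMap 0 r θ)‖ : ℝ) := fun θ => by
    rw [hcirc, logAbs_of_ne_zero (hmem θ).2]; rfl
  have hz' : logAbs f z = (Real.log ‖(f ∘ γ) 0‖ : ℝ) := by
    rw [logAbs_of_ne_zero h0]; simp [γ]
  rw [hz', ← havg]
  refine EReal.coe_le_coe_iff.2 (average_le_truncAvg ?_ ?_ hq (fun θ => (heq θ).ge) M)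
  · simp_rw [heq]
    exact (continuous_coe_real_ereal.comp hq).upperSemicontinuous
  · exact fun θ => elog_lt_top _

theorem HoloNear.pshNear_logAbs {f : Cn n → ℂ} (hf : HoloNear f)
    (h0 : ¬ ∀ᶠ z in 𝓝 (0 : Cn n), f z = 0) : PSHNear (logAbs f) := by
  obtain ⟨R, hR, hd⟩ := hf.eventually_ball
  refine (PSHOn.of_ball ?_ (fun z _ => elog_lt_top _) ?_ fun z hz w => ?_).pshNear hR
  · have : ContinuousOn (logAbs f) (Metric.ball 0 R) := by
      have h1 : logAbs f = fun z => ENNReal.log (ENNReal.ofReal ‖f z‖) := by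
        ext z
        exact elog_eq_log_ofReal _
      rw [h1]
      exact ENNReal.continuous_log.comp_continuousOn
        (ENNReal.continuous_ofReal.comp_continuousOn hd.continuousOn.norm)
    exact this.upperSemicontinuousOn
  · by_contra! hcon
    exact h0 (eventually_of_mem (Metric.ball_mem_nhds _ hR)
      fun z hz => logAbs_eq_bot_iff.1 (hcon z hz))
  · obtain ⟨ε, hε, h⟩ := subMean_logAbs Metric.isOpen_ball hd hz w
    exact ⟨ε, hε, fun r hr hrε _ => h r hr hrε⟩

theorem logAbs_add_le (f g : Cn n → ℂ) (z : Cn n) :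
    logAbs (fun z => f z + g z) z ≤ max (logAbs f z) (logAbs g z) + (Real.log 2 : ℝ) := by
  have key : elog (2 * max ‖f z‖ ‖g z‖) ≤ max (elog ‖f z‖) (elog ‖g z‖) + (Real.log 2 : ℝ) := by
    rw [← elog_mono.map_max]
    unfold elog
    rcases (le_max_of_le_left (norm_nonneg (f z)) : 0 ≤ max ‖f z‖ ‖g z‖).eq_or_lt with h | h
    · simp [← h]
    · rw [if_neg (by linarith), if_neg (by linarith), Real.log_mul two_ne_zero h.ne', add_comm,
        EReal.coe_add]
  refine (elog_mono ?_).trans key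
  refine (norm_add_le _ _).trans ?_
  have := le_max_left ‖f z‖ ‖g z‖
  have := le_max_right ‖f z‖ ‖g z‖
  linarith

theorem zhouNumber_nonneg (ψ Φ : Cn n → EReal) : 0 ≤ zhouNumber ψ Φ :=
  Real.sSup_nonneg fun _ hb => hb.1

theorem leO_of_lt_zhouNumber {ψ Φ : Cn n → EReal}
    (hΦ : ∃ C : ℝ, ∀ᶠ z in 𝓝 (0 : Cn n), Φ z ≤ C) {x : ℝ} (hx : 0 ≤ x)
    (h : x < zhouNumber ψ Φ) : leO ψ fun z => (x : EReal) * Φ z := by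
  have hne : {b : ℝ | 0 ≤ b ∧ leO ψ fun z => (b : EReal) * Φ z}.Nonempty := by
    by_contra hem
    rw [Set.not_nonempty_iff_eq_empty] at hem
    rw [zhouNumber, hem, Real.sSup_empty] at h
    linarith
  obtain ⟨b, hb, hxb⟩ := exists_lt_of_lt_csSup hne h
  exact leO_mul_of_le hΦ hx hxb.le hb.2

theorem leO_mul_add_mul {ψ₁ ψ₂ Φ : Cn n → EReal} {c₁ c₂ b₁ b₂ : ℝ} (hc₁ : 0 ≤ c₁) (hc₂ : 0 ≤ c₂)
    (hb₁ : 0 ≤ b₁) (hb₂ : 0 ≤ b₂) (h₁ : leO ψ₁ fun z => (b₁ : EReal) * Φ z)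
    (h₂ : leO ψ₂ fun z => (b₂ : EReal) * Φ z) :
    leO (fun z => (c₁ : EReal) * ψ₁ z + (c₂ : EReal) * ψ₂ z)
      fun z => ((c₁ * b₁ + c₂ * b₂ : ℝ) : EReal) * Φ z := by
  have key : ∀ {c b D : ℝ} {x y : EReal}, 0 ≤ c → y ≤ (b : EReal) * x + D →
      (c : EReal) * y ≤ ((c * b : ℝ) : EReal) * x + ((c * D : ℝ) : EReal) := by
    intro c b D x y hc h
    rcases hc.eq_or_lt with rfl | hc
    · simp
    · simpa using affine_le_of_le_mul_add (d := 0) hc h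
  obtain ⟨D₁, hD₁⟩ := h₁
  obtain ⟨D₂, hD₂⟩ := h₂
  refine ⟨c₁ * D₁ + c₂ * D₂, ?_⟩
  filter_upwards [hD₁, hD₂] with z hz₁ hz₂
  refine (add_le_add (key hc₁ hz₁) (key hc₂ hz₂)).trans (le_of_eq ?_)
  rw [add_add_add_comm, EReal.coe_add (c₁ * D₁), EReal.coe_add (c₁ * b₁),
    EReal.right_distrib_of_nonneg]
  · exact_mod_cast mul_nonneg hc₁ hb₁
  · exact_mod_cast mul_nonneg hc₂ hb₂

theorem IntNear.add {g h : Cn n → ℝ≥0∞} (hg : IntNear g) (hh : IntNear h)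
    (hm : ∃ R > 0, AEMeasurable g (volume.restrict (Metric.ball 0 R))) :
    IntNear fun z => g z + h z := by
  obtain ⟨R₁, hR₁, h₁⟩ := hg.exists_ball
  obtain ⟨R₂, hR₂, h₂⟩ := hh.exists_ball
  obtain ⟨R₃, hR₃, hm⟩ := hm
  set R := min R₃ (min R₁ R₂) with hR
  refine ⟨Metric.ball 0 R, Metric.ball_mem_nhds _ (lt_min hR₃ (lt_min hR₁ hR₂)), ?_⟩
  rw [lintegral_add_left' (hm.mono_measure
    (Measure.restrict_mono (Metric.ball_subset_ball (min_le_left _ _)) le_rfl))]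
  exact ENNReal.add_lt_top.2 ⟨h₁ R ((min_le_right _ _).trans (min_le_left _ _)),
    h₂ R ((min_le_right _ _).trans (min_le_right _ _))⟩

theorem PSHNear.max_affine {u v : Cn n → EReal} (hu : PSHNear u) (hv : PSHNear v) {a : ℝ}
    (ha : 0 < a) (b : ℝ) : PSHNear fun z => max (u z) ((a : EReal) * v z + b) := by
  obtain ⟨R₁, hR₁, h₁⟩ := hu.exists_ball
  obtain ⟨R₂, hR₂, h₂⟩ := hv.exists_ball
  have hR := lt_min hR₁ hR₂
  have hu := (h₁ _ hR (min_le_left _ _)).1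
  obtain ⟨p, hp, hpb⟩ := hu.not_botOnComponents 0 (Metric.mem_ball_self hR)
  exact (hu.max_affine (h₂ _ hR (min_le_right _ _)).1
    ⟨p, connectedComponentIn_subset _ _ hp, hpb⟩ ha b).pshNear hR

theorem PSHNear.exists_aemeasurable_mul_wexp {W : Cn n → ℝ≥0∞} {u : Cn n → EReal} (hu : PSHNear u)
    (hWm : ∃ R > 0, AEMeasurable W (volume.restrict (Metric.ball 0 R))) :
    ∃ R > 0, AEMeasurable (fun z => W z * wexp (-2) u z) (volume.restrict (Metric.ball 0 R)) := by
  obtain ⟨R₁, hR₁, h₁⟩ := hu.exists_ball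
  obtain ⟨R₂, hR₂, h₂⟩ := hWm
  have hR := lt_min hR₁ hR₂
  refine ⟨min R₁ R₂, hR, (h₂.mono_measure (Measure.restrict_mono
    (Metric.ball_subset_ball (min_le_right _ _)) le_rfl)).mul ?_⟩
  exact expNegTwo_antitone.measurable.comp_aemeasurable
    (aemeasurable_restrict_of_upperSemicontinuousOn measurableSet_ball
      (h₁ _ hR (min_le_left _ _)).1.usc)

theorem IsZhouWeightFor.intNear_max {W : Cn n → ℝ≥0∞} {Φ ψ : Cn n → EReal}
    (hΦ : IsZhouWeightFor W Φ) (hψ : PSHNear ψ) {s : ℝ} (hs : 0 < s)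
    (h : ¬ leO ψ fun z => (s : EReal) * Φ z) :
    IntNear fun z => W z * wexp (-2) (fun z => max (Φ z) ((s⁻¹ : ℝ) * ψ z + (0 : ℝ))) z := by
  by_contra hnon
  obtain ⟨⟨D, hD⟩, -⟩ := hΦ.maximal _ (hΦ.psh.max_affine hψ (inv_pos.2 hs) 0)
    ⟨0, Eventually.of_forall fun z => by simp⟩ hnon
  refine h ⟨s * D, ?_⟩
  filter_upwards [hD] with z hz
  have h1 : ((s⁻¹ : ℝ) : EReal) * ψ z + ((0 : ℝ) : EReal) ≤ ((1 : ℝ) : EReal) * Φ z + D := by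
    rw [EReal.coe_one, one_mul]
    exact (le_max_right _ _).trans hz
  have h2 := affine_le_of_le_mul_add (d := 0) hs h1
  have h3 : (s : EReal) * ((s⁻¹ : ℝ) * ψ z) = ψ z := by
    rw [← mul_assoc, ← EReal.coe_mul, mul_inv_cancel₀ hs.ne', EReal.coe_one, one_mul]
  simpa [h3] using h2

theorem le_of_weighted_sum_le {x y₁ y₂ : EReal} {b c₁ c₂ s₁ s₂ C : ℝ} (hc₁ : 0 ≤ c₁) (hc₂ : 0 ≤ c₂)
    (hs₁ : 0 < s₁) (hs₂ : 0 < s₂) (hb : c₁ * s₁ + c₂ * s₂ < b) (hx : x < ⊤) (hy₁ : y₁ < ⊤)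
    (hy₂ : y₂ < ⊤) (h₁ : x < (s₁⁻¹ : ℝ) * y₁ + (0 : ℝ)) (h₂ : x < (s₂⁻¹ : ℝ) * y₂ + (0 : ℝ))
    (h : (c₁ : EReal) * y₁ + (c₂ : EReal) * y₂ ≤ (b : EReal) * x + C) :
    ((-(C / (b - (c₁ * s₁ + c₂ * s₂))) : ℝ) : EReal) ≤ x := by
  have hb0 : 0 < b := lt_of_le_of_lt (by positivity) hb
  have real : ∀ {s : ℝ} {y : EReal}, 0 < s → y < ⊤ → x < (s⁻¹ : ℝ) * y + (0 : ℝ) →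
      ∃ t : ℝ, y = t := by
    intro s y hs hy hlt
    induction y with
    | bot => simp [EReal.coe_mul_bot_of_pos (inv_pos.2 hs)] at hlt
    | top => simp at hy
    | coe t => exact ⟨t, rfl⟩
  obtain ⟨t₁, rfl⟩ := real hs₁ hy₁ h₁
  obtain ⟨t₂, rfl⟩ := real hs₂ hy₂ h₂
  induction x with
  | top => simp at hx
  | bot =>
    rw [EReal.coe_mul_bot_of_pos hb0, EReal.bot_add, ← EReal.coe_mul, ← EReal.coe_mul,
      ← EReal.coe_add, le_bot_iff] at h
    exact absurd h (EReal.coe_ne_bot _)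
  | coe x =>
    have h₁ : x < s₁⁻¹ * t₁ + 0 := by exact_mod_cast h₁
    have h₂ : x < s₂⁻¹ * t₂ + 0 := by exact_mod_cast h₂
    have h : c₁ * t₁ + c₂ * t₂ ≤ b * x + C := by exact_mod_cast h
    rw [add_zero, inv_mul_eq_div, lt_div_iff₀ ‹_›] at h₁ h₂
    rw [EReal.coe_le_coe_iff, neg_le, le_div_iff₀ (by linarith)]
    nlinarith [mul_le_mul_of_nonneg_left h₁.le hc₁, mul_le_mul_of_nonneg_left h₂.le hc₂]

theorem IsZhouWeightFor.le_of_leO {W : Cn n → ℝ≥0∞} {Φ ψ₁ ψ₂ : Cn n → EReal}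
    (hΦ : IsZhouWeightFor W Φ) (hW : IntNear W)
    (hWm : ∃ R > 0, AEMeasurable W (volume.restrict (Metric.ball 0 R)))
    (hψ₁ : PSHNear ψ₁) (hψ₂ : PSHNear ψ₂) {c₁ c₂ s₁ s₂ b : ℝ} (hc₁ : 0 ≤ c₁) (hc₂ : 0 ≤ c₂)
    (hs₁ : 0 < s₁) (hs₂ : 0 < s₂) (h₁ : ¬ leO ψ₁ fun z => (s₁ : EReal) * Φ z)
    (h₂ : ¬ leO ψ₂ fun z => (s₂ : EReal) * Φ z)
    (h : leO (fun z => (c₁ : EReal) * ψ₁ z + (c₂ : EReal) * ψ₂ z) fun z => (b : EReal) * Φ z) :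
    b ≤ c₁ * s₁ + c₂ * s₂ := by
  by_contra! hb
  obtain ⟨C, hC⟩ := h
  set K := C / (b - (c₁ * s₁ + c₂ * s₂)) with hK
  have hlt : ∀ {u : Cn n → EReal}, PSHNear u → ∀ᶠ z in 𝓝 (0 : Cn n), u z < ⊤ := by
    intro u ⟨U, hU, _, hu⟩
    filter_upwards [hU] with z hz using hu.lt_top z hz
  have hsum := (hW.const_mul (c := expNegTwo ((-K : ℝ) : EReal))
    (by rw [expNegTwo_coe]; exact ENNReal.ofReal_ne_top)).add
    ((hΦ.intNear_max hψ₁ hs₁ h₁).add (hΦ.intNear_max hψ₂ hs₂ h₂)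
      ((hΦ.psh.max_affine hψ₁ (inv_pos.2 hs₁) 0).exists_aemeasurable_mul_wexp hWm))
    (hWm.imp fun R hR => ⟨hR.1, hR.2.const_mul _⟩)
  refine hΦ.nonint (hsum.mono ?_)
  filter_upwards [hC, hlt hΦ.psh, hlt hψ₁, hlt hψ₂] with z hz hx hy₁ hy₂
  simp only [wexp_neg_two]
  by_cases hcase₁ : ((s₁⁻¹ : ℝ) : EReal) * ψ₁ z + ((0 : ℝ) : EReal) ≤ Φ z
  · rw [max_eq_left hcase₁]
    exact le_add_left (le_add_right le_rfl)
  by_cases hcase₂ : ((s₂⁻¹ : ℝ) : EReal) * ψ₂ z + ((0 : ℝ) : EReal) ≤ Φ z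
  · rw [max_eq_left hcase₂]
    exact le_add_left (le_add_left le_rfl)
  refine le_add_right ?_
  rw [mul_comm]
  exact mul_le_mul_left (expNegTwo_antitone (le_of_weighted_sum_le hc₁ hc₂ hs₁ hs₂ hb hx hy₁ hy₂
    (not_le.1 hcase₁) (not_le.1 hcase₂) hz)) _

theorem HoloNear.add {f g : Cn n → ℂ} (hf : HoloNear f) (hg : HoloNear g) :
    HoloNear fun z => f z + g z := by
  obtain ⟨U, hU, hUo, hfU⟩ := hf
  obtain ⟨V, hV, hVo, hgV⟩ := hg
  exact ⟨U ∩ V, inter_mem hU hV, hUo.inter hVo,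
    (hfU.mono Set.inter_subset_left).add (hgV.mono Set.inter_subset_right)⟩

theorem IsZhouWeightFor.zhouNumber_add {W : Cn n → ℝ≥0∞} {Φ ψ₁ ψ₂ : Cn n → EReal}
    (hΦ : IsZhouWeightFor W Φ) (hW : IntNear W)
    (hWm : ∃ R > 0, AEMeasurable W (volume.restrict (Metric.ball 0 R)))
    (hψ₁ : PSHNear ψ₁) (hψ₂ : PSHNear ψ₂) {c₁ c₂ : ℝ} (hc₁ : 0 ≤ c₁) (hc₂ : 0 ≤ c₂) :
    zhouNumber (fun z => (c₁ : EReal) * ψ₁ z + (c₂ : EReal) * ψ₂ z) Φ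
      = c₁ * zhouNumber ψ₁ Φ + c₂ * zhouNumber ψ₂ Φ := by
  have hb₁ := hΦ.bddAbove hW hWm hψ₁
  have hb₂ := hΦ.bddAbove hW hWm hψ₂
  have hz₁ : leO ψ₁ fun z => ((0 : ℝ) : EReal) * Φ z := leO_zero_mul hψ₁.exists_bound
  have hz₂ : leO ψ₂ fun z => ((0 : ℝ) : EReal) * Φ z := leO_zero_mul hψ₂.exists_bound
  have hub : ∀ b ∈ {b : ℝ | 0 ≤ b ∧ leO (fun z => (c₁ : EReal) * ψ₁ z + (c₂ : EReal) * ψ₂ z)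
      fun z => (b : EReal) * Φ z}, b ≤ c₁ * zhouNumber ψ₁ Φ + c₂ * zhouNumber ψ₂ Φ := by
    rintro b ⟨-, hb⟩
    refine le_of_forall_pos_le_add fun η hη => ?_
    set t := η / (c₁ + c₂ + 1) with ht
    have ht0 : 0 < t := by positivity
    have htη : t * (c₁ + c₂ + 1) = η := div_mul_cancel₀ _ (by positivity)
    have hσ₁ := zhouNumber_nonneg ψ₁ Φ
    have hσ₂ := zhouNumber_nonneg ψ₂ Φ
    have := hΦ.le_of_leO hW hWm hψ₁ hψ₂ hc₁ hc₂ (s₁ := zhouNumber ψ₁ Φ + t)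
      (s₂ := zhouNumber ψ₂ Φ + t) (by linarith) (by linarith)
      (fun h => by
        have := le_csSup hb₁ ⟨by linarith, h⟩
        rw [zhouNumber] at this
        linarith)
      (fun h => by
        have := le_csSup hb₂ ⟨by linarith, h⟩
        rw [zhouNumber] at this
        linarith) hb
    nlinarith
  refine le_antisymm (csSup_le ⟨0, le_rfl, ?_⟩ hub) ?_
  · simpa using leO_mul_add_mul hc₁ hc₂ le_rfl le_rfl hz₁ hz₂
  refine le_of_forall_pos_le_add fun η hη => ?_
  set t := η / (c₁ + c₂ + 1) with ht
  have ht0 : 0 < t := by positivity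
  have htη : t * (c₁ + c₂ + 1) = η := div_mul_cancel₀ _ (by positivity)
  obtain ⟨b₁, hbm₁, hlt₁⟩ := exists_lt_of_lt_csSup
    (s := {b : ℝ | 0 ≤ b ∧ leO ψ₁ fun z => (b : EReal) * Φ z}) ⟨0, le_rfl, hz₁⟩
    (sub_lt_self (zhouNumber ψ₁ Φ) ht0)
  obtain ⟨b₂, hbm₂, hlt₂⟩ := exists_lt_of_lt_csSup
    (s := {b : ℝ | 0 ≤ b ∧ leO ψ₂ fun z => (b : EReal) * Φ z}) ⟨0, le_rfl, hz₂⟩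
    (sub_lt_self (zhouNumber ψ₂ Φ) ht0)
  have hmem : c₁ * b₁ + c₂ * b₂ ≤ zhouNumber (fun z => (c₁ : EReal) * ψ₁ z + (c₂ : EReal) * ψ₂ z) Φ :=
    le_csSup ⟨_, hub⟩ ⟨add_nonneg (mul_nonneg hc₁ hbm₁.1) (mul_nonneg hc₂ hbm₂.1),
      leO_mul_add_mul hc₁ hc₂ hbm₁.1 hbm₂.1 hbm₁.2 hbm₂.2⟩
  nlinarith [mul_le_mul_of_nonneg_left hlt₁.le hc₁, mul_le_mul_of_nonneg_left hlt₂.le hc₂]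

theorem leO.max {ψ₁ ψ₂ φ : Cn n → EReal} (h₁ : leO ψ₁ φ) (h₂ : leO ψ₂ φ) :
    leO (fun z => max (ψ₁ z) (ψ₂ z)) φ := by
  obtain ⟨C₁, hC₁⟩ := h₁
  obtain ⟨C₂, hC₂⟩ := h₂
  refine ⟨Max.max C₁ C₂, ?_⟩
  filter_upwards [hC₁, hC₂] with z hz₁ hz₂
  refine max_le (hz₁.trans (add_le_add_right ?_ _)) (hz₂.trans (add_le_add_right ?_ _))
  · exact_mod_cast le_max_left _ _
  · exact_mod_cast le_max_right _ _

theorem leO.of_le {ψ ψ' φ : Cn n → EReal} {D : ℝ} (h : leO ψ' φ) (hle : ∀ z, ψ z ≤ ψ' z + D) :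
    leO ψ φ := by
  obtain ⟨C, hC⟩ := h
  refine ⟨C + D, ?_⟩
  filter_upwards [hC] with z hz
  rw [EReal.coe_add, ← add_assoc]
  exact (hle z).trans (add_le_add_left hz _)

theorem min_zhouNumber_le {ψ₁ ψ₂ ψ Φ : Cn n → EReal} {D : ℝ}
    (hΦ : ∃ C : ℝ, ∀ᶠ z in 𝓝 (0 : Cn n), Φ z ≤ C)
    (hb : BddAbove {b : ℝ | 0 ≤ b ∧ leO ψ fun z => (b : EReal) * Φ z})
    (hle : ∀ z, ψ z ≤ max (ψ₁ z) (ψ₂ z) + D) :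
    min (zhouNumber ψ₁ Φ) (zhouNumber ψ₂ Φ) ≤ zhouNumber ψ Φ := by
  by_contra! hlt
  obtain ⟨x, hx, hx'⟩ := exists_between hlt
  have hx0 := (zhouNumber_nonneg ψ Φ).trans hx.le
  have h₁ := leO_of_lt_zhouNumber hΦ hx0 (hx'.trans_le (min_le_left _ _))
  have h₂ := leO_of_lt_zhouNumber hΦ hx0 (hx'.trans_le (min_le_right _ _))
  exact hx.not_ge (le_csSup hb ⟨hx0, (h₁.max h₂).of_le hle⟩)

/-- tropical multiplicativity and additivity of Zhou numbers. -/
theorem statement3 {n m : ℕ} (f₀ : Fin m → Cn n → ℂ) (φ₀ Φ : Cn n → EReal)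
    (hΦ : IsLocalZhouWeight f₀ φ₀ Φ)
    (ψ₁ ψ₂ : Cn n → EReal) (hψ₁ : PSHNear ψ₁) (hψ₂ : PSHNear ψ₂) :
    (∀ c₁ c₂ : ℝ, 0 ≤ c₁ → 0 ≤ c₂ →
      zhouNumber (fun z => (c₁ : EReal) * ψ₁ z + (c₂ : EReal) * ψ₂ z) Φ
        = c₁ * zhouNumber ψ₁ Φ + c₂ * zhouNumber ψ₂ Φ) ∧
    (∀ f₁ f₂ : Cn n → ℂ, HoloNear f₁ → HoloNear f₂ →
      ¬ (∀ᶠ z in 𝓝 (0 : Cn n), f₁ z + f₂ z = 0) →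
      min (zhouNumber (logAbs f₁) Φ) (zhouNumber (logAbs f₂) Φ)
        ≤ zhouNumber (logAbs fun z => f₁ z + f₂ z) Φ) ∧
    zhouNumber (fun z => max (ψ₁ z) (ψ₂ z)) Φ
      = min (zhouNumber ψ₁ Φ) (zhouNumber ψ₂ Φ) := by
  have hW := hΦ.int₀
  have hWm := aemeasurable_dens0 hΦ.holo hΦ.psh₀
  have hbd := hΦ.zhou.psh.exists_bound
  refine ⟨fun c₁ c₂ hc₁ hc₂ => hΦ.zhou.zhouNumber_add hW hWm hψ₁ hψ₂ hc₁ hc₂,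
    fun f₁ f₂ hf₁ hf₂ hne => ?_, ?_⟩
  · exact min_zhouNumber_le hbd
      (hΦ.zhou.bddAbove hW hWm ((hf₁.add hf₂).pshNear_logAbs hne)) (logAbs_add_le f₁ f₂)
  · have hle : ∀ b : ℝ, (0 ≤ b ∧ leO (fun z => max (ψ₁ z) (ψ₂ z)) fun z => (b : EReal) * Φ z) →
        (0 ≤ b ∧ leO ψ₁ fun z => (b : EReal) * Φ z) ∧
        (0 ≤ b ∧ leO ψ₂ fun z => (b : EReal) * Φ z) := fun b hb =>
      ⟨⟨hb.1, hb.2.of_le (D := 0) (by simp)⟩, ⟨hb.1, hb.2.of_le (D := 0) (by simp)⟩⟩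
    have hb₁ := hΦ.zhou.bddAbove hW hWm hψ₁
    have hb₂ := hΦ.zhou.bddAbove hW hWm hψ₂
    refine le_antisymm (csSup_le ⟨0, le_rfl, ?_⟩ fun b hb => ?_)
      (min_zhouNumber_le (D := 0) hbd (hb₁.mono fun b hb => (hle b hb).1) (by simp))
    · exact (leO_zero_mul hψ₁.exists_bound).max (leO_zero_mul hψ₂.exists_bound)
    · exact le_min (le_csSup hb₁ (hle b hb).1) (le_csSup hb₂ (hle b hb).2)
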